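/- Let k ∈ ℕ with k ≥ 2, let F be a family of holomorphic functions on the unit disk 𝔻 each of which is locally univalent (i.e., f' has no zeros in 𝔻), and let b be a meromorphic function on 𝔻 such that S_k(f)(z) ≠ b(z) for every f ∈ F and every z ∈ 𝔻. Then the family F''/F' = { f''/f' : f ∈ F } is normal on 𝔻. -/

import Mathlib

open Complex Filter Set Metric Topology

noncomputable section

/-- The open unit disk `𝔻`. -/
def unitDisk : Set ℂ := Metric.ball (0 : ℂ) 1

/-- The logarithmic derivative of `f'`, i.e. `f''/f'`. -/
def ldd (f : ℂ → ℂ) : ℂ → ℂ := fun z => deriv (deriv f) z / deriv f z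

/-- `SRec n f m` is the generalized Schwarzian `S_{m+2,n}(f)`. -/
def SRec (n : ℕ) (f : ℂ → ℂ) : ℕ → ℂ → ℂ
  | 0 => ldd f
  | m + 1 => fun z => deriv (SRec n f m) z - (1 / (n : ℂ)) * ldd f z * SRec n f m z

/-- `SGen n k f` is `S_{k,n}(f)` (for `k ≥ 2`). -/
def SGen (n k : ℕ) (f : ℂ → ℂ) : ℂ → ℂ := SRec n f (k - 2)

/-- The generalized Schwarzian derivative of order `k`: `S_k(f) = S_{k+1,k}(f)`. -/
def Sk (k : ℕ) (f : ℂ → ℂ) : ℂ → ℂ := SGen k (k + 1) f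

/-- `f` is a non-constant meromorphic function on `U`: near no point of `U`
is `f` eventually equal to a constant. -/
def NonConstOn (f : ℂ → ℂ) (U : Set ℂ) : Prop :=
  ¬ ∃ c : ℂ, ∃ z ∈ U, ∀ᶠ w in 𝓝[≠] z, f w = c

/-- `E` has no accumulation point in `U`. -/
def NoAccIn (E U : Set ℂ) : Prop := ∀ z ∈ U, ¬ AccPt z (𝓟 E)

/-- The family `M_{k,M}`: (non-constant) meromorphic functions on `𝔻` whose generalized
Schwarzian derivative `S_k(f)` is holomorphic on `𝔻` with `‖S_k(f)‖_∞ ≤ M`, i.e. it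
coincides (away from a set without accumulation points in `𝔻`) with a function `g`
holomorphic on `𝔻` and bounded by `M`. -/
def MFam (k : ℕ) (M : ℝ) : Set (ℂ → ℂ) :=
  {f | MeromorphicOn f unitDisk ∧ NonConstOn f unitDisk ∧
    ∃ g : ℂ → ℂ, AnalyticOnNhd ℂ g unitDisk ∧ (∀ z ∈ unitDisk, ‖g z‖ ≤ M) ∧
      NoAccIn {w ∈ unitDisk | Sk k f w ≠ g w} unitDisk}

/-- The family `H_{k,M} = M_{k,M} ∩ H(𝔻)`. -/
def HFam (k : ℕ) (M : ℝ) : Set (ℂ → ℂ) :=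
  {f ∈ MFam k M | AnalyticOnNhd ℂ f unitDisk}

/-- The chordal (spherical) distance on the Riemann sphere `ℂ ∪ {∞}`. -/
def sphDist (x y : OnePoint ℂ) : ℝ :=
  Option.elim x (Option.elim y 0 fun w => 1 / Real.sqrt (1 + ‖w‖ ^ 2))
    fun z =>
      Option.elim y (1 / Real.sqrt (1 + ‖z‖ ^ 2)) fun w =>
        ‖z - w‖ / (Real.sqrt (1 + ‖z‖ ^ 2) * Real.sqrt (1 + ‖w‖ ^ 2))

/-- Locally uniform convergence on `U` with respect to the spherical metric. -/
def TendstoLocUnifSph (F : ℕ → ℂ → ℂ) (g : ℂ → OnePoint ℂ) (U : Set ℂ) : Prop :=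
  ∀ ε > (0 : ℝ), ∀ x ∈ U, ∃ t ∈ 𝓝[U] x,
    ∀ᶠ n in atTop, ∀ y ∈ t, sphDist (F n y : OnePoint ℂ) (g y) < ε

/-- A family of (meromorphic) functions is normal on `U` if every sequence has a
subsequence converging locally uniformly on `U` w.r.t. the spherical metric. -/
def NormalOn (𝓕 : Set (ℂ → ℂ)) (U : Set ℂ) : Prop :=
  ∀ F : ℕ → ℂ → ℂ, (∀ n, F n ∈ 𝓕) →
    ∃ φ : ℕ → ℕ, StrictMono φ ∧
      ∃ g : ℂ → OnePoint ℂ, TendstoLocUnifSph (fun n => F (φ n)) g U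

/-- A family is quasi-normal on `U` if every sequence has a subsequence converging
locally uniformly (spherically) off some exceptional set `E ⊆ U` without
accumulation points in `U`. -/
def QuasiNormalOn (𝓕 : Set (ℂ → ℂ)) (U : Set ℂ) : Prop :=
  ∀ F : ℕ → ℂ → ℂ, (∀ n, F n ∈ 𝓕) →
    ∃ φ : ℕ → ℕ, StrictMono φ ∧ ∃ E : Set ℂ, E ⊆ U ∧ NoAccIn E U ∧
      ∃ g : ℂ → OnePoint ℂ, TendstoLocUnifSph (fun n => F (φ n)) g (U \ E)

/-- A family is locally uniformly bounded on `U`. -/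
def LocUnifBddOn (𝓕 : Set (ℂ → ℂ)) (U : Set ℂ) : Prop :=
  ∀ x ∈ U, ∃ t ∈ 𝓝[U] x, ∃ C : ℝ, ∀ f ∈ 𝓕, ∀ y ∈ t, ‖f y‖ ≤ C

/-- Cauchy's estimate for the derivative at the centre of a disk. -/
theorem norm_deriv_le_of_ball {f : ℂ → ℂ} {z : ℂ} {r C : ℝ} (hr : 0 < r)
    (hf : DifferentiableOn ℂ f (ball z r)) (hC : ∀ w ∈ ball z r, ‖f w‖ ≤ C) :
    ‖deriv f z‖ ≤ 2 * C / r := by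
  have h2 : closedBall z (r / 2) ⊆ ball z r := closedBall_subset_ball (by linarith)
  have h1 : ‖deriv f z‖ ≤ C / (r / 2) := by
    apply norm_deriv_le_of_forall_mem_sphere_norm_le (by linarith)
    · refine DifferentiableOn.diffContOnCl ?_
      rw [closure_ball _ (by positivity)]
      exact hf.mono h2
    · exact fun w hw => hC w (h2 (sphere_subset_closedBall hw))
  refine h1.trans (le_of_eq ?_)
  field_simp

/-- A zero-free holomorphic function on a disk has a holomorphic logarithm. -/
theorem exists_log_on_ball {f : ℂ → ℂ} {z : ℂ} {r : ℝ} (hr : 0 < r)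
    (hf : DifferentiableOn ℂ f (ball z r)) (h0 : ∀ w ∈ ball z r, f w ≠ 0) :
    ∃ g : ℂ → ℂ, (∀ w ∈ ball z r, HasDerivAt g (deriv f w / f w) w) ∧
      ∀ w ∈ ball z r, f w = exp (g w) := by
  have hz : z ∈ ball z r := mem_ball_self hr
  have hd : DifferentiableOn ℂ (fun w => deriv f w / f w) (ball z r) :=
    (hf.deriv isOpen_ball).div hf h0
  obtain ⟨g, hg⟩ := hd.isExactOn_ball
  have hconst : ∀ w ∈ ball z r, f w * exp (-g w) = f z * exp (-g z) := by
    intro w hw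
    refine (convex_ball z r).is_const_of_fderivWithin_eq_zero (𝕜 := ℂ)
      (f := fun w => f w * exp (-g w)) ?_ ?_ hw hz
    · intro x hx
      exact ((hf.differentiableAt (isOpen_ball.mem_nhds hx)).mul
        (hg x hx).differentiableAt.neg.cexp).differentiableWithinAt
    · intro x hx
      have h1 := (hf.differentiableAt (isOpen_ball.mem_nhds hx)).hasDerivAt
      have h2 := h1.mul (hg x hx).neg.cexp
      have h3 : HasDerivAt (fun w => f w * exp (-g w)) 0 x := by
        refine h2.congr_deriv ?_
        field_simp [h0 x hx]
        simp
      rw [fderivWithin_of_isOpen isOpen_ball hx, h3.hasFDerivAt.fderiv]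
      ext; simp
  refine ⟨fun w => g w - g z + log (f z), fun w hw => ?_, fun w hw => ?_⟩
  · simpa using ((hg w hw).sub_const (g z)).add_const (log (f z))
  · have := hconst w hw
    rw [exp_add, exp_log (h0 z hz), exp_sub]
    rw [exp_neg, exp_neg] at this
    field_simp at this ⊢
    linear_combination this

/-- The map `w ↦ (w - a) / (w + conj a)` sends the right half-plane into the unit disk. -/
theorem norm_sub_div_add_conj_lt_one {a w : ℂ} (ha : 0 < a.re) (hw : 0 < w.re) :
    ‖(w - a) / (w + (starRingEnd ℂ) a)‖ < 1 := by
  have h1 : 0 < ‖w + (starRingEnd ℂ) a‖ := by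
    rw [norm_pos_iff]
    intro h
    have := congrArg Complex.re h
    simp at this
    linarith
  rw [norm_div, div_lt_one h1]
  apply lt_of_pow_lt_pow_left₀ 2 h1.le
  rw [Complex.sq_norm, Complex.sq_norm, normSq_apply, normSq_apply]
  simp
  nlinarith

/-- Harnack-type estimates for a holomorphic map of a disk into the right half-plane. -/
theorem halfPlane_schwarz {F : ℂ → ℂ} {z : ℂ} {r : ℝ} (hr : 0 < r)
    (hF : DifferentiableOn ℂ F (ball z r)) (hpos : ∀ w ∈ ball z r, 0 < (F w).re) :
    ‖deriv F z‖ ≤ 2 * (F z).re / r ∧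
      ∀ w ∈ ball z r, (F z).re * (r - dist w z) / (2 * r) ≤ (F w).re := by
  have hz : z ∈ ball z r := mem_ball_self hr
  set a := F z with ha
  have hapos : 0 < a.re := hpos z hz
  have hne : ∀ w ∈ ball z r, F w + (starRingEnd ℂ) a ≠ 0 := by
    intro w hw h
    have := congrArg Complex.re h
    simp at this
    linarith [hpos w hw]
  set φ : ℂ → ℂ := fun w => (F w - a) / (F w + (starRingEnd ℂ) a) with hφ
  have hφz : φ z = 0 := by simp [hφ, ← ha]
  have hφd : DifferentiableOn ℂ φ (ball z r) :=
    (hF.sub_const a).div (hF.add_const _) hne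
  have hmaps : MapsTo φ (ball z r) (closedBall (φ z) 1) := by
    intro w hw
    rw [hφz, mem_closedBall_zero_iff]
    exact (norm_sub_div_add_conj_lt_one hapos (hpos w hw)).le
  constructor
  · have h1 := norm_deriv_le_div_of_mapsTo_ball hφd hmaps hr
    have hFz : HasDerivAt F (deriv F z) z :=
      (hF.differentiableAt (isOpen_ball.mem_nhds hz)).hasDerivAt
    have h2 : HasDerivAt φ (deriv F z / (2 * a.re : ℝ)) z := by
      have := (hFz.sub_const a).div (hFz.add_const ((starRingEnd ℂ) a)) (hne z hz)
      refine this.congr_deriv ?_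
      rw [← ha, sub_self, zero_mul, sub_zero, add_conj]
      have : ((2 * a.re : ℝ) : ℂ) ≠ 0 := by
        exact_mod_cast (by positivity : (2 * a.re : ℝ) ≠ 0)
      field_simp
    rw [h2.deriv, norm_div, Complex.norm_real, Real.norm_of_nonneg (by positivity)] at h1
    rw [div_le_iff₀ (by positivity)] at h1
    calc _ ≤ _ := h1
      _ = _ := by ring
  · intro w hw
    have h1 := dist_le_div_mul_dist_of_mapsTo_ball hφd hmaps hw
    rw [hφz, dist_zero_right] at h1
    set t := dist w z with ht
    have ht0 : 0 ≤ t := dist_nonneg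
    have htr : t < r := hw
    set b := F w with hb
    have hbpos : 0 < b.re := hpos w hw
    have hden : 0 < ‖b + (starRingEnd ℂ) a‖ := norm_pos_iff.mpr (hne w hw)
    have h2 : ‖b - a‖ ≤ t / r * ‖b + (starRingEnd ℂ) a‖ := by
      have : ‖φ w‖ = ‖b - a‖ / ‖b + (starRingEnd ℂ) a‖ := by simp [hφ, hb]
      rw [this, div_le_iff₀ hden] at h1
      calc _ ≤ _ := h1
        _ = _ := by ring
    have h3 : ‖b - a‖ ^ 2 ≤ (t / r) ^ 2 * ‖b + (starRingEnd ℂ) a‖ ^ 2 := by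
      rw [← mul_pow]; gcongr
    rw [Complex.sq_norm, Complex.sq_norm, normSq_apply, normSq_apply] at h3
    simp at h3
    set s := t / r with hs
    have hs0 : 0 ≤ s := by positivity
    have hs1 : s < 1 := (div_lt_one hr).mpr htr
    have h4 : (b.re - a.re) ^ 2 ≤ s ^ 2 * (b.re + a.re) ^ 2 := by
      nlinarith [mul_nonneg (sub_nonneg.2 (pow_le_one₀ hs0 hs1.le : s ^ 2 ≤ 1))
        (sq_nonneg (b.im - a.im))]
    have h5 : a.re - b.re ≤ s * (b.re + a.re) := by
      rw [← mul_pow] at h4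
      have := abs_le_of_sq_le_sq' h4 (by positivity)
      linarith [this.1]
    have h6 : a.re * (r - t) / (2 * r) = a.re * (1 - s) / 2 := by
      rw [hs]; field_simp
    rw [h6]
    nlinarith

theorem norm_le_exp_of_norm_le_one {h : ℂ → ℂ} {z y : ℂ} {r M : ℝ}
    (hd : DifferentiableOn ℂ h (ball z r))
    (hM : ∀ w ∈ ball z r, ‖deriv h w‖ ≤ M * (1 + ‖h w‖ ^ 2))
    (hy : y ∈ ball z r) (hy1 : ‖h y‖ ≤ 1) : ‖h z‖ ≤ Real.exp (4 * M * dist y z) := by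
  have hr : 0 < r := dist_nonneg.trans_lt hy
  have hM0 : 0 ≤ M := by
    have := (norm_nonneg _).trans (hM y hy)
    by_contra! hneg
    nlinarith [sq_nonneg ‖h y‖]
  by_cases hz1 : ‖h z‖ ≤ 1
  · exact hz1.trans (Real.one_le_exp (by positivity))
  push Not at hz1
  have hsub : closedBall z (dist y z) ⊆ ball z r := closedBall_subset_ball hy
  set K := closedBall z (dist y z) ∩ (fun w => ‖h w‖) ⁻¹' Iic 1 with hK
  have hKc : IsCompact K :=
    (isCompact_closedBall z _).of_isClosed_subset
      ((hd.continuousOn.mono hsub).norm.preimage_isClosed_of_isClosed isClosed_closedBall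
        isClosed_Iic) inter_subset_left
  have hKn : K.Nonempty := ⟨y, by simp [hK, mem_closedBall, hy1]⟩
  obtain ⟨z₁, hz₁K, hmin⟩ := hKc.exists_isMinOn hKn (f := fun w => dist w z) (by fun_prop)
  have hz₁1 : ‖h z₁‖ ≤ 1 := hz₁K.2
  have hz₁r : z₁ ∈ ball z r := hsub hz₁K.1
  have hRy : dist z₁ z ≤ dist y z := hz₁K.1
  set R := dist z₁ z with hR
  have hRpos : 0 < R := by
    rw [hR, dist_pos]
    rintro rfl
    linarith
  have hsubR : ball z R ⊆ ball z r := ball_subset_ball (le_of_lt hz₁r)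
  have hbig : ∀ w ∈ ball z R, 1 < ‖h w‖ := by
    intro w hw
    by_contra! hcon
    have hwK : w ∈ K := ⟨ball_subset_closedBall (ball_subset_ball hRy hw), hcon⟩
    have : R ≤ dist w z := hmin hwK
    exact absurd hw (not_lt.mpr this)
  obtain ⟨F, hF, hFe⟩ := exists_log_on_ball hRpos (hd.mono hsubR)
    (fun w hw h0 => by have := hbig w hw; rw [h0, norm_zero] at this; linarith)
  have hFre : ∀ w ∈ ball z R, (F w).re = Real.log ‖h w‖ := by
    intro w hw
    rw [hFe w hw, norm_exp, Real.log_exp]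
  have hFpos : ∀ w ∈ ball z R, 0 < (F w).re := by
    intro w hw
    rw [hFre w hw]
    exact Real.log_pos (hbig w hw)
  have hH := (halfPlane_schwarz hRpos
    (fun w hw => (hF w hw).differentiableAt.differentiableWithinAt) hFpos).2
  set L := Real.log ‖h z‖ with hL
  -- the radial derivative of `‖h‖ ^ 2` at the boundary point `z₁`
  set γ : ℝ → ℂ := fun t => h (z₁ + t * (z - z₁)) with hγ
  have hγd : HasDerivAt γ (deriv h z₁ * (z - z₁)) 0 := by
    have h1 : HasDerivAt (fun t : ℝ => z₁ + (t : ℂ) * (z - z₁)) (z - z₁) 0 := by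
      simpa using ((Complex.ofRealCLM.hasDerivAt (x := (0 : ℝ))).mul_const (z - z₁)).const_add z₁
    have h2 : HasDerivAt h (deriv h z₁) (z₁ + ((0 : ℝ) : ℂ) * (z - z₁)) := by
      simpa using (hd.differentiableAt (isOpen_ball.mem_nhds hz₁r)).hasDerivAt
    exact h2.comp (0 : ℝ) h1
  have hγ2 : HasDerivAt (fun t => ‖γ t‖ ^ 2) (2 * inner ℝ (γ 0) (deriv h z₁ * (z - z₁))) 0 :=
    hγd.norm_sq
  have hγ0 : γ 0 = h z₁ := by simp [hγ]
  have hLle : L ≤ 2 * inner ℝ (γ 0) (deriv h z₁ * (z - z₁)) := by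
    have hslope := (hasDerivAt_iff_tendsto_slope.mp hγ2).mono_left
      (nhdsWithin_mono 0 (fun t (ht : t ∈ Ioi (0 : ℝ)) => (ne_of_gt ht)))
    refine ge_of_tendsto hslope ?_
    filter_upwards [Ioo_mem_nhdsGT (zero_lt_one' ℝ)] with t ht
    have hdist : dist (z₁ + (t : ℂ) * (z - z₁)) z = (1 - t) * R := by
      rw [dist_eq_norm, hR, dist_eq_norm]
      rw [show z₁ + (t : ℂ) * (z - z₁) - z = ((1 - t : ℝ) : ℂ) * (z₁ - z) by push_cast; ring,
        norm_mul, Complex.norm_real, Real.norm_of_nonneg (by linarith [ht.2])]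
    have hin : z₁ + (t : ℂ) * (z - z₁) ∈ ball z R := by
      rw [mem_ball, hdist]; nlinarith [ht.1]
    have h1 := hH _ hin
    rw [hdist, hFre z (mem_ball_self hRpos), hFre _ hin] at h1
    have h2 : L * (R - (1 - t) * R) / (2 * R) = L * t / 2 := by field_simp; ring
    rw [← hL, h2] at h1
    have h3 : Real.log (‖γ t‖ ^ 2) ≤ ‖γ t‖ ^ 2 - 1 :=
      Real.log_le_sub_one_of_pos (by have := hbig _ hin; positivity)
    rw [Real.log_pow] at h3
    push_cast at h3
    rw [slope_def_field, hγ0, sub_zero, le_div_iff₀ ht.1]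
    have h4 : ‖h z₁‖ ^ 2 ≤ 1 := pow_le_one₀ (norm_nonneg _) hz₁1
    change L * t / 2 ≤ Real.log ‖γ t‖ at h1
    linarith
  have hLle2 : L ≤ 4 * M * R := by
    refine hLle.trans ?_
    have h1 : inner ℝ (γ 0) (deriv h z₁ * (z - z₁)) ≤ ‖γ 0‖ * ‖deriv h z₁ * (z - z₁)‖ :=
      real_inner_le_norm _ _
    rw [norm_mul, hγ0, ← dist_eq_norm, dist_comm z z₁] at h1
    have h2 : ‖deriv h z₁‖ ≤ M * 2 := by
      refine (hM z₁ hz₁r).trans ?_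
      gcongr
      nlinarith [norm_nonneg (h z₁)]
    have h3 : ‖h z₁‖ * (‖deriv h z₁‖ * R) ≤ 1 * (M * 2 * R) := by gcongr
    rw [hγ0]
    linarith
  have : ‖h z‖ = Real.exp L := (Real.exp_log (by linarith)).symm
  rw [this]
  gcongr
  refine hLle2.trans ?_
  gcongr

/-- A holomorphic function with bounded spherical derivative grows at most exponentially with
the distance from the points where it is small. -/
theorem norm_le_exp_of_norm_deriv_le {h : ℂ → ℂ} {z y : ℂ} {r M A : ℝ} (hA : 1 ≤ A)
    (hd : DifferentiableOn ℂ h (ball z r))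
    (hM : ∀ w ∈ ball z r, ‖deriv h w‖ ≤ M * (1 + ‖h w‖ ^ 2))
    (hy : y ∈ ball z r) (hy1 : ‖h y‖ ≤ A) :
    ‖h z‖ ≤ A * Real.exp (4 * (M * A) * dist y z) := by
  have hM0 : 0 ≤ M := by
    have := (norm_nonneg _).trans (hM y hy)
    by_contra! hneg
    nlinarith [sq_nonneg ‖h y‖]
  have hA0 : 0 < A := by linarith
  have hnorm : ∀ w : ℂ, ‖w / (A : ℂ)‖ = ‖w‖ / A := fun w => by
    rw [norm_div, Complex.norm_real, Real.norm_of_nonneg hA0.le]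
  have key := norm_le_exp_of_norm_le_one (h := fun w => h w / (A : ℂ)) (z := z) (y := y)
    (r := r) (M := M * A) (hd.div_const _) ?_ hy ?_
  · rw [hnorm, div_le_iff₀ hA0] at key
    linarith
  · intro w hw
    rw [deriv_div_const, hnorm, hnorm, div_le_iff₀ hA0, div_pow]
    refine (hM w hw).trans ?_
    have : M * A * (1 + ‖h w‖ ^ 2 / A ^ 2) * A = M * (A ^ 2 + ‖h w‖ ^ 2) := by
      field_simp
    rw [this]
    gcongr
    nlinarith
  · rw [hnorm, div_le_one hA0]
    exact hy1

/-- `riccatiPoly h j` is the differential polynomial `u⁽ʲ⁾ / u`, where `u' = h u`. -/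
def riccatiPoly (h : ℂ → ℂ) : ℕ → ℂ → ℂ
  | 0 => fun _ => 1
  | j + 1 => fun z => deriv (riccatiPoly h j) z + h z * riccatiPoly h j z

/-- The differential polynomial `U ^ j * riccatiPoly U⁻¹ j`. -/
def recipRiccati (U : ℂ → ℂ) : ℕ → ℂ → ℂ
  | 0 => fun _ => 1
  | j + 1 => fun z => recipRiccati U j z + U z * deriv (recipRiccati U j) z
      - j * deriv U z * recipRiccati U j z

theorem differentiableOn_riccatiPoly {h : ℂ → ℂ} {s : Set ℂ} (hs : IsOpen s)
    (hd : DifferentiableOn ℂ h s) (j : ℕ) : DifferentiableOn ℂ (riccatiPoly h j) s := by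
  induction j with
  | zero => exact differentiableOn_const _
  | succ j ih => exact (ih.deriv hs).add (hd.mul ih)

theorem differentiableOn_recipRiccati {U : ℂ → ℂ} {s : Set ℂ} (hs : IsOpen s)
    (hd : DifferentiableOn ℂ U s) (j : ℕ) : DifferentiableOn ℂ (recipRiccati U j) s := by
  induction j with
  | zero => exact differentiableOn_const _
  | succ j ih =>
    exact (ih.add (hd.mul (ih.deriv hs))).sub (((hd.deriv hs).const_mul _).mul ih)

/-- The invariance of `riccatiPoly` under affine changes of variable. -/
theorem riccatiPoly_scale (h : ℂ → ℂ) (a ρ : ℂ) (j : ℕ) (z : ℂ) :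
    riccatiPoly (fun w => ρ * h (a + ρ * w)) j z = ρ ^ j * riccatiPoly h j (a + ρ * z) := by
  induction j generalizing z with
  | zero => simp [riccatiPoly]
  | succ j ih =>
    have h1 : riccatiPoly (fun w => ρ * h (a + ρ * w)) j =
        fun z => ρ ^ j * riccatiPoly h j (a + ρ * z) := funext ih
    have h2 : deriv (fun z => ρ ^ j * riccatiPoly h j (a + ρ * z)) z =
        ρ ^ j * (ρ * deriv (riccatiPoly h j) (a + ρ * z)) := by
      rw [deriv_const_mul_field]
      congr 1
      have := deriv_comp_mul_left ρ (fun w => riccatiPoly h j (a + w)) z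
      rw [this, deriv_comp_const_add, smul_eq_mul]
    simp only [riccatiPoly]
    rw [h1, h2]
    ring

theorem recipRiccati_eq {U : ℂ → ℂ} {s : Set ℂ} (hs : IsOpen s) (hd : DifferentiableOn ℂ U s)
    (h0 : ∀ z ∈ s, U z ≠ 0) (j : ℕ) :
    ∀ z ∈ s, recipRiccati U j z = U z ^ j * riccatiPoly (fun w => (U w)⁻¹) j z := by
  induction j with
  | zero => simp [recipRiccati, riccatiPoly]
  | succ j ih =>
    intro z hz
    have hUd := (hd.differentiableAt (hs.mem_nhds hz)).hasDerivAt
    have hPd := ((differentiableOn_riccatiPoly hs (hd.inv h0) j).differentiableAt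
      (hs.mem_nhds hz)).hasDerivAt
    have h1 : deriv (recipRiccati U j) z =
        (j * U z ^ (j - 1) * deriv U z) * riccatiPoly (fun w => (U w)⁻¹) j z +
          U z ^ j * deriv (riccatiPoly (fun w => (U w)⁻¹) j) z := by
      have : recipRiccati U j =ᶠ[𝓝 z] fun w => U w ^ j * riccatiPoly (fun w => (U w)⁻¹) j w :=
        eventually_of_mem (hs.mem_nhds hz) ih
      rw [this.deriv_eq]
      exact ((hUd.pow j).mul hPd).deriv
    simp only [recipRiccati, riccatiPoly]
    rw [h1, ih z hz]
    have := h0 z hz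
    rcases j with _ | j
    · simp; field_simp; ring
    · simp only [Nat.add_sub_cancel]
      field_simp
      ring

theorem ball_half_subset {z w : ℂ} {r : ℝ} (hw : w ∈ ball z (r / 2)) :
    ball w (r / 2) ⊆ ball z r := by
  apply ball_subset_ball'
  rw [mem_ball] at hw
  linarith

theorem exists_norm_riccatiPoly_le (j : ℕ) (A : ℝ) {r : ℝ} (hr : 0 < r) :
    ∃ C : ℝ, ∀ (h : ℂ → ℂ) (z : ℂ), DifferentiableOn ℂ h (ball z r) →
      (∀ w ∈ ball z r, ‖h w‖ ≤ A) → ‖riccatiPoly h j z‖ ≤ C := by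
  induction j generalizing r with
  | zero => exact ⟨1, fun h z _ _ => by simp [riccatiPoly]⟩
  | succ j ih =>
    obtain ⟨C, hC⟩ := ih (half_pos hr)
    refine ⟨2 * C / (r / 2) + A * C, fun h z hd hA => ?_⟩
    have hP : ∀ w ∈ ball z (r / 2), ‖riccatiPoly h j w‖ ≤ C := fun w hw =>
      hC h w (hd.mono (ball_half_subset hw)) fun x hx => hA x (ball_half_subset hw hx)
    have hz : z ∈ ball z (r / 2) := mem_ball_self (half_pos hr)
    refine (norm_add_le _ _).trans (add_le_add ?_ ?_)
    · exact norm_deriv_le_of_ball (half_pos hr) (differentiableOn_riccatiPoly isOpen_ball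
        (hd.mono (ball_subset_ball (by linarith))) j) hP
    · rw [norm_mul]
      have h1 := hA z (mem_ball_self hr)
      exact mul_le_mul h1 (hP z hz) (norm_nonneg _) ((norm_nonneg _).trans h1)

theorem exists_norm_recipRiccati_sub_one_le (j : ℕ) {r : ℝ} (hr : 0 < r) :
    ∃ C : ℝ, 0 ≤ C ∧ ∀ (U : ℂ → ℂ) (z : ℂ) (ε : ℝ), ε ≤ 1 → DifferentiableOn ℂ U (ball z r) →
      (∀ w ∈ ball z r, ‖U w‖ ≤ ε) → ‖recipRiccati U j z - 1‖ ≤ C * ε ∧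
        ‖recipRiccati U j z - 1 + (j.choose 2 : ℂ) * deriv U z‖ ≤ C * ε ^ 2 := by
  induction j generalizing r with
  | zero =>
    refine ⟨0, le_rfl, fun U z ε _ _ _ => ?_⟩
    simp [recipRiccati]
  | succ j ih =>
    obtain ⟨C, hC0, hC⟩ := ih (half_pos hr)
    refine ⟨C + 4 * C / r + 2 * j * C / r + 2 * j / r, by positivity, fun U z ε hε hd hU => ?_⟩
    have hε0 : 0 ≤ ε := (norm_nonneg _).trans (hU z (mem_ball_self hr))
    have hz : z ∈ ball z (r / 2) := mem_ball_self (half_pos hr)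
    have hT : ∀ w ∈ ball z (r / 2), ‖recipRiccati U j w - 1‖ ≤ C * ε := fun w hw =>
      (hC U w ε hε (hd.mono (ball_half_subset hw)) fun x hx => hU x (ball_half_subset hw hx)).1
    have hT2 := (hC U z ε hε (hd.mono (ball_half_subset hz))
      fun x hx => hU x (ball_half_subset hz hx)).2
    have hT1 := hT z hz
    have hdT : ‖deriv (recipRiccati U j) z‖ ≤ 4 * C / r * ε := by
      have := norm_deriv_le_of_ball (f := fun w => recipRiccati U j w - 1) (half_pos hr)
        ((differentiableOn_recipRiccati isOpen_ball
          (hd.mono (ball_subset_ball (by linarith))) j).sub_const 1) hT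
      rw [deriv_sub_const] at this
      refine this.trans (le_of_eq ?_)
      field_simp; ring
    have hdU : ‖deriv U z‖ ≤ 2 / r * ε := by
      refine (norm_deriv_le_of_ball hr hd hU).trans (le_of_eq ?_)
      ring
    set T := recipRiccati U j z with hTdef
    have e1 : recipRiccati U (j + 1) z - 1 = (T - 1) + U z * deriv (recipRiccati U j) z
        - j * deriv U z * (T - 1) - j * deriv U z := by
      simp only [recipRiccati]; ring
    have e2 : recipRiccati U (j + 1) z - 1 + ((j + 1).choose 2 : ℂ) * deriv U z =
        (T - 1 + (j.choose 2 : ℂ) * deriv U z) + U z * deriv (recipRiccati U j) z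
        - j * deriv U z * (T - 1) := by
      rw [Nat.choose_succ_succ' j 1]
      simp only [recipRiccati, Nat.choose_one_right]
      push_cast; ring
    have b1 : ‖U z * deriv (recipRiccati U j) z‖ ≤ 4 * C / r * ε ^ 2 := by
      rw [norm_mul]
      calc _ ≤ ε * (4 * C / r * ε) := by
            gcongr
            exact hU z (mem_ball_self hr)
        _ = _ := by ring
    have b2 : ‖(j : ℂ) * deriv U z * (T - 1)‖ ≤ 2 * j * C / r * ε ^ 2 := by
      rw [norm_mul, norm_mul, Complex.norm_natCast]
      calc _ ≤ j * (2 / r * ε) * (C * ε) := by gcongr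
        _ = _ := by ring
    have b3 : ‖(j : ℂ) * deriv U z‖ ≤ 2 * j / r * ε := by
      rw [norm_mul, Complex.norm_natCast]
      calc _ ≤ j * (2 / r * ε) := by gcongr
        _ = _ := by ring
    have hεsq : ε ^ 2 ≤ ε := by nlinarith
    constructor
    · rw [e1]
      calc _ ≤ C * ε + 4 * C / r * ε ^ 2 + 2 * j * C / r * ε ^ 2 + 2 * j / r * ε := by
            refine (norm_sub_le _ _).trans (add_le_add ?_ b3)
            refine (norm_sub_le _ _).trans (add_le_add ?_ b2)
            exact (norm_add_le _ _).trans (add_le_add hT1 b1)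
        _ ≤ C * ε + 4 * C / r * ε + 2 * j * C / r * ε + 2 * j / r * ε := by gcongr
        _ = _ := by ring
    · rw [e2]
      calc _ ≤ C * ε ^ 2 + 4 * C / r * ε ^ 2 + 2 * j * C / r * ε ^ 2 := by
            refine (norm_sub_le _ _).trans (add_le_add ?_ b2)
            exact (norm_add_le _ _).trans (add_le_add hT2 b1)
        _ ≤ C * ε ^ 2 + 4 * C / r * ε ^ 2 + 2 * j * C / r * ε ^ 2 + 2 * j / r * ε ^ 2 := by
            have : 0 ≤ 2 * j / r * ε ^ 2 := by positivity
            linarith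
        _ = _ := by ring

/-- Where `h` is large on a disk, `riccatiPoly h k` is comparable to `h ^ k`. -/
theorem exists_norm_pow_le_riccatiPoly (k : ℕ) {r : ℝ} (hr : 0 < r) :
    ∃ A : ℝ, 1 ≤ A ∧ ∀ (h : ℂ → ℂ) (z : ℂ), DifferentiableOn ℂ h (ball z r) →
      (∀ w ∈ ball z r, A ≤ ‖h w‖) → ‖h z‖ ^ k / 2 ≤ ‖riccatiPoly h k z‖ := by
  obtain ⟨C, hC0, hC⟩ := exists_norm_recipRiccati_sub_one_le k hr
  refine ⟨2 * C + 1, by linarith, fun h z hd hA => ?_⟩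
  have hpos : (0 : ℝ) < 2 * C + 1 := by linarith
  have hne : ∀ w ∈ ball z r, h w ≠ 0 := fun w hw h0 => by
    have := hA w hw
    rw [h0, norm_zero] at this
    linarith
  have h1 := (hC (fun w => (h w)⁻¹) z (2 * C + 1)⁻¹ (inv_le_one_of_one_le₀ (by linarith))
    (hd.inv hne) (fun w hw => by rw [norm_inv]; exact inv_anti₀ hpos (hA w hw))).1
  have h2 : C * (2 * C + 1)⁻¹ ≤ 1 / 2 := by
    rw [← div_eq_mul_inv, div_le_iff₀ hpos]; linarith
  have hz := mem_ball_self (x := z) hr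
  rw [recipRiccati_eq (U := fun w => (h w)⁻¹) isOpen_ball (hd.inv hne)
    (fun w hw => inv_ne_zero (hne w hw)) k z hz] at h1
  simp only [inv_inv] at h1
  have h3 : 1 / 2 ≤ ‖(h z)⁻¹ ^ k * riccatiPoly h k z‖ := by
    have := norm_sub_norm_le (1 : ℂ) (1 - (h z)⁻¹ ^ k * riccatiPoly h k z)
    rw [norm_sub_rev] at h1
    rw [sub_sub_cancel, norm_one] at this
    change ‖1 - (h z)⁻¹ ^ k * riccatiPoly h k z‖ ≤ _ at h1
    linarith
  have h4 : 0 < ‖h z‖ := norm_pos_iff.mpr (hne z hz)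
  rw [norm_mul, norm_pow, norm_inv, inv_pow, inv_mul_eq_div, le_div_iff₀ (by positivity)] at h3
  linarith

/-- Asymptotics of `w h - k h'`, with `h = U⁻¹`, where `w` is the logarithmic derivative of
`riccatiPoly h k` and `h` is large. -/
theorem exists_norm_riccati_remainder_le (k : ℕ) (hk : 1 ≤ k) {W : ℝ} (hW : 0 ≤ W) :
    ∃ ε₀ > 0, ∃ C : ℝ, ∀ (U w : ℂ → ℂ) (z : ℂ), DifferentiableOn ℂ U (ball z 1) →
      DifferentiableOn ℂ w (ball z 1) → (∀ x ∈ ball z 1, U x ≠ 0) →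
      (∀ x ∈ ball z 1, ‖U x‖ ≤ ε₀) → (∀ x ∈ ball z 1, ‖w x‖ ≤ W) →
      (∀ x ∈ ball z 1, deriv (riccatiPoly (fun y => (U y)⁻¹) k) x =
        w x * riccatiPoly (fun y => (U y)⁻¹) k x) →
      ‖w z / U z + k * deriv U z / U z ^ 2 +
        (k.choose 2 : ℂ) * ((w z / k) ^ 2 - deriv w z / k)‖ ≤ C * ‖U z‖ := by
  obtain ⟨C₁, hC₁0, hC₁⟩ := exists_norm_recipRiccati_sub_one_le k (half_pos one_pos)
  obtain ⟨C₂, hC₂0, hC₂⟩ := exists_norm_recipRiccati_sub_one_le k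
    (show (0 : ℝ) < 1 / 8 by norm_num)
  set Λ : ℝ := Real.exp (8 + W) with hΛ
  have hΛ0 : 0 < Λ := Real.exp_pos _
  have hΛ1 : 1 ≤ Λ := Real.one_le_exp (by linarith)
  have hkR : (1 : ℝ) ≤ k := by exact_mod_cast hk
  have hkC : (k : ℂ) ≠ 0 := by exact_mod_cast (by omega : k ≠ 0)
  refine ⟨min Λ⁻¹ (2 * C₁ + 1)⁻¹, by positivity,
    64 * C₂ * Λ * (C₂ * Λ) + 16 * C₂ * Λ ^ 2 +
      (k.choose 2) * (2048 * C₂ * Λ + 64 * C₂ * Λ * (64 * C₂ + 2 * W)), ?_⟩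
  intro U w z hUd hwd hU0 hUε hwW hode
  have hε1 : min Λ⁻¹ (2 * C₁ + 1)⁻¹ ≤ 1 := (min_le_left _ _).trans (inv_le_one_of_one_le₀ hΛ1)
  have hz : z ∈ ball z 1 := mem_ball_self one_pos
  set T := recipRiccati U k with hTdef
  have hTd : DifferentiableOn ℂ T (ball z 1) := differentiableOn_recipRiccati isOpen_ball hUd k
  have hTeq := recipRiccati_eq isOpen_ball hUd hU0 k
  -- the logarithmic derivative of `T`
  have hTlog : ∀ x ∈ ball z 1, deriv T x = (k * (deriv U x / U x) + w x) * T x := by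
    intro x hx
    have hnx := isOpen_ball.mem_nhds hx
    have h1 : T =ᶠ[𝓝 x] fun y => U y ^ k * riccatiPoly (fun y => (U y)⁻¹) k y :=
      eventually_of_mem hnx hTeq
    have h2 := ((hUd.differentiableAt hnx).hasDerivAt.pow k).mul
      ((differentiableOn_riccatiPoly isOpen_ball (hUd.inv hU0) k).differentiableAt hnx).hasDerivAt
    have h3 : deriv T x = k * U x ^ (k - 1) * deriv U x * riccatiPoly (fun y => (U y)⁻¹) k x +
        U x ^ k * deriv (riccatiPoly (fun y => (U y)⁻¹) k) x := by
      rw [h1.deriv_eq]; exact h2.deriv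
    rw [h3, hode x hx, hTdef, hTeq x hx]
    have := hU0 x hx
    obtain ⟨m, rfl⟩ : ∃ m, k = m + 1 := ⟨k - 1, by omega⟩
    simp only [Nat.add_sub_cancel]
    field_simp
    ring
  have hT1 : ∀ x ∈ ball z (1 / 2), ‖T x - 1‖ ≤ 1 / 2 := by
    intro x hx
    have hsub := ball_half_subset hx
    have := (hC₁ U x _ hε1 (hUd.mono hsub) fun y hy => hUε y (hsub hy)).1
    refine this.trans ?_
    calc _ ≤ C₁ * (2 * C₁ + 1)⁻¹ := by gcongr; exact min_le_right _ _
      _ ≤ 1 / 2 := by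
        rw [← div_eq_mul_inv, div_le_iff₀ (by positivity)]; linarith
  have hThalf : ∀ x ∈ ball z (1 / 2), 1 / 2 ≤ ‖T x‖ := by
    intro x hx
    have h1 := hT1 x hx
    have h2 := norm_sub_norm_le (1 : ℂ) (1 - T x)
    rw [norm_sub_rev] at h1
    rw [sub_sub_cancel, norm_one] at h2
    linarith
  have hT0 : ∀ x ∈ ball z (1 / 2), T x ≠ 0 := fun x hx h0 => by
    have := hThalf x hx
    rw [h0, norm_zero] at this
    norm_num at this
  have sub1 : ball z (1 / 2) ⊆ ball z 1 := ball_subset_ball (by norm_num)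
  have sub2 : ball z (1 / 4) ⊆ ball z (1 / 2) := ball_subset_ball (by norm_num)
  have sub3 : ball z (1 / 8) ⊆ ball z (1 / 4) := ball_subset_ball (by norm_num)
  have sub4 : ball z (1 / 16) ⊆ ball z (1 / 8) := ball_subset_ball (by norm_num)
  have hderivT : ∀ x ∈ ball z (1 / 4), ‖deriv T x‖ ≤ 4 := by
    intro x hx
    have hs : ball x (1 / 4) ⊆ ball z (1 / 2) := by
      apply ball_subset_ball'; rw [mem_ball] at hx; linarith
    have := norm_deriv_le_of_ball (f := fun y => T y - 1) (r := 1 / 4) (by norm_num)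
      ((hTd.mono (hs.trans sub1)).sub_const 1) fun y hy => hT1 y (hs hy)
    rw [deriv_sub_const] at this
    linarith
  have hℓ : ∀ x ∈ ball z (1 / 4), ‖deriv U x / U x‖ ≤ 8 + W := by
    intro x hx
    have h1 := hTlog x (sub1 (sub2 hx))
    have h2 : k * (deriv U x / U x) = deriv T x / T x - w x := by
      rw [h1]; field_simp [hT0 x (sub2 hx)]; ring
    have h3 : ‖deriv T x / T x‖ ≤ 8 := by
      rw [norm_div, div_le_iff₀ (norm_pos_iff.mpr (hT0 x (sub2 hx)))]
      linarith [hderivT x hx, hThalf x (sub2 hx)]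
    have h4 : ‖(k : ℂ) * (deriv U x / U x)‖ ≤ 8 + W := by
      rw [h2]
      exact (norm_sub_le _ _).trans (add_le_add h3 (hwW x (sub1 (sub2 hx))))
    rw [norm_mul, Complex.norm_natCast] at h4
    nlinarith [norm_nonneg (deriv U x / U x)]
  have hUle : ∀ x ∈ ball z (1 / 4), ‖U x‖ ≤ Λ * ‖U z‖ := by
    obtain ⟨G, hG, hGe⟩ := exists_log_on_ball (show (0 : ℝ) < 1 / 4 by norm_num)
      (hUd.mono (sub2.trans sub1)) fun x hx => hU0 x (sub1 (sub2 hx))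
    intro x hx
    have hz4 : z ∈ ball z (1 / 4) := mem_ball_self (by norm_num)
    have h1 := (convex_ball z (1 / 4)).norm_image_sub_le_of_norm_hasDerivWithin_le
      (f := G) (f' := fun x => deriv U x / U x) (C := 8 + W)
      (fun x hx => (hG x hx).hasDerivWithinAt) hℓ hz4 hx
    have h2 : ‖G x - G z‖ ≤ 8 + W := by
      refine h1.trans ?_
      have : ‖x - z‖ ≤ 1 := by
        rw [← dist_eq_norm]; rw [mem_ball] at hx; linarith
      nlinarith [norm_nonneg (x - z)]
    have h3 : U x = exp (G x - G z) * U z := by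
      rw [hGe x hx, hGe z hz4, ← exp_add]; ring_nf
    rw [h3, norm_mul, norm_exp, hΛ]
    gcongr
    exact (re_le_norm _).trans h2
  set u := ‖U z‖ with hu
  have hu0 : 0 < u := norm_pos_iff.mpr (hU0 z hz)
  have hε : Λ * u ≤ 1 := by
    have : u ≤ Λ⁻¹ := (hUε z hz).trans (min_le_left _ _)
    calc Λ * u ≤ Λ * Λ⁻¹ := by gcongr
      _ = 1 := mul_inv_cancel₀ hΛ0.ne'
  have hB : ∀ x ∈ ball z (1 / 8), ‖T x - 1‖ ≤ C₂ * (Λ * u) ∧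
      ‖T x - 1 + (k.choose 2 : ℂ) * deriv U x‖ ≤ C₂ * (Λ * u) ^ 2 := by
    intro x hx
    have hs : ball x (1 / 8) ⊆ ball z (1 / 4) := by
      apply ball_subset_ball'; rw [mem_ball] at hx; linarith
    exact hC₂ U x _ hε (hUd.mono (hs.trans (sub2.trans sub1))) fun y hy => hUle y (hs hy)
  have hz8 : z ∈ ball z (1 / 8) := mem_ball_self (by norm_num)
  have hz16 : z ∈ ball z (1 / 16) := mem_ball_self (by norm_num)
  have hz2 : z ∈ ball z (1 / 2) := mem_ball_self (by norm_num)
  set τ : ℂ → ℂ := fun x => deriv T x / T x with hτ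
  have hτd : DifferentiableOn ℂ τ (ball z (1 / 2)) :=
    ((hTd.deriv isOpen_ball).mono sub1).div (hTd.mono sub1) hT0
  have hτle : ∀ x ∈ ball z (1 / 16), ‖τ x‖ ≤ 64 * C₂ * (Λ * u) := by
    intro x hx
    have hs : ball x (1 / 16) ⊆ ball z (1 / 8) := by
      apply ball_subset_ball'; rw [mem_ball] at hx; linarith
    have h1 := norm_deriv_le_of_ball (f := fun y => T y - 1) (r := 1 / 16) (by norm_num)
      ((hTd.mono (hs.trans (sub3.trans (sub2.trans sub1)))).sub_const 1)
      fun y hy => (hB y (hs hy)).1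
    rw [deriv_sub_const] at h1
    have h2 := hThalf x (sub2 (sub3 (sub4 hx)))
    have h3 := hT0 x (sub2 (sub3 (sub4 hx)))
    rw [hτ, norm_div, div_le_iff₀ (norm_pos_iff.mpr h3)]
    have h4 : 0 ≤ C₂ * (Λ * u) := by positivity
    calc _ ≤ 2 * (C₂ * (Λ * u)) / (1 / 16) := h1
      _ = 64 * C₂ * (Λ * u) * (1 / 2) := by ring
      _ ≤ _ := by gcongr
  have hτ' : ‖deriv τ z‖ ≤ 2048 * C₂ * (Λ * u) := by
    refine (norm_deriv_le_of_ball (r := 1 / 16) (by norm_num)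
      (hτd.mono (sub4.trans (sub3.trans sub2))) hτle).trans (le_of_eq ?_)
    ring
  have hτz := hτle z hz16
  set E : ℂ → ℂ := fun x => T x - 1 + (k.choose 2 : ℂ) * deriv U x with hE
  have hUd' : DifferentiableOn ℂ (deriv U) (ball z 1) := hUd.deriv isOpen_ball
  have hE' : ‖deriv E z‖ ≤ 16 * C₂ * (Λ * u) ^ 2 := by
    refine (norm_deriv_le_of_ball (r := 1 / 8) (by norm_num)
      ((((hTd.sub_const 1).add (hUd'.const_mul _))).mono (sub3.trans (sub2.trans sub1)))
      fun y hy => (hB y hy).2).trans (le_of_eq ?_)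
    ring
  have hnz := isOpen_ball.mem_nhds hz
  have hTz := (hTd.differentiableAt hnz).hasDerivAt
  have hU'z := (hUd'.differentiableAt hnz).hasDerivAt
  have hUz := (hUd.differentiableAt hnz).hasDerivAt
  have hwz := (hwd.differentiableAt hnz).hasDerivAt
  have hτz' := (hτd.differentiableAt (isOpen_ball.mem_nhds hz2)).hasDerivAt
  have hE'eq : deriv E z = deriv T z + (k.choose 2 : ℂ) * deriv (deriv U) z :=
    ((hTz.sub_const 1).add (hU'z.const_mul _)).deriv
  have hU' : ∀ x ∈ ball z (1 / 2), deriv U x = (τ x - w x) / k * U x := by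
    intro x hx
    have := hTlog x (sub1 hx)
    have h0 := hU0 x (sub1 hx)
    have h1 := hT0 x hx
    simp only [hτ, this]
    field_simp
    ring
  have hU'' : deriv (deriv U) z =
      (deriv τ z - deriv w z) / k * U z + ((τ z - w z) / k) ^ 2 * U z := by
    have h1 : deriv U =ᶠ[𝓝 z] fun x => (τ x - w x) / k * U x :=
      eventually_of_mem (isOpen_ball.mem_nhds hz2) hU'
    have h2 := (((hτz'.sub hwz).div_const (k : ℂ)).mul hUz).deriv
    rw [h1.deriv_eq]
    refine Eq.trans h2 ?_
    rw [hU' z hz2]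
    simp only [Pi.sub_apply]
    ring
  have hUz0 := hU0 z hz
  have hTz0 := hT0 z hz2
  have hτz0 : τ z * T z = deriv T z := by simp only [hτ]; field_simp
  have hid : w z / U z + k * deriv U z / U z ^ 2 +
      (k.choose 2 : ℂ) * ((w z / k) ^ 2 - deriv w z / k) =
      τ z / U z * (1 - T z) + deriv E z / U z -
        (k.choose 2 : ℂ) * (deriv τ z / k + τ z * (τ z - 2 * w z) / k ^ 2) := by
    rw [hE'eq, ← hτz0, hU'', hU' z hz2]
    field_simp
    ring
  rw [hid]
  have n1 : ‖τ z / U z * (1 - T z)‖ ≤ 64 * C₂ * Λ * (C₂ * Λ) * u := by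
    rw [norm_mul, norm_div, norm_sub_rev]
    have : ‖τ z‖ / u ≤ 64 * C₂ * Λ := by
      rw [div_le_iff₀ hu0]; linarith
    calc _ ≤ (64 * C₂ * Λ) * (C₂ * (Λ * u)) := by
          gcongr
          exact (hB z hz8).1
      _ = _ := by ring
  have n2 : ‖deriv E z / U z‖ ≤ 16 * C₂ * Λ ^ 2 * u := by
    rw [norm_div, div_le_iff₀ hu0]
    refine hE'.trans (le_of_eq ?_)
    ring
  have n3 : ‖deriv τ z / k‖ ≤ 2048 * C₂ * Λ * u := by
    rw [norm_div, Complex.norm_natCast, div_le_iff₀ (by linarith)]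
    have h0 : 0 ≤ 2048 * C₂ * Λ * u := by positivity
    nlinarith
  have n4 : ‖τ z * (τ z - 2 * w z) / k ^ 2‖ ≤ 64 * C₂ * Λ * (64 * C₂ + 2 * W) * u := by
    rw [norm_div, norm_pow, Complex.norm_natCast, norm_mul]
    have h1 : ‖τ z - 2 * w z‖ ≤ 64 * C₂ + 2 * W := by
      refine (norm_sub_le _ _).trans (add_le_add ?_ ?_)
      · refine hτz.trans ?_
        have : 0 ≤ 64 * C₂ := by positivity
        nlinarith
      · rw [norm_mul]
        simpa using hwW z hz
    have h2 : (1 : ℝ) ≤ (k : ℝ) ^ 2 := one_le_pow₀ hkR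
    refine (div_le_self (by positivity) h2).trans ?_
    calc _ ≤ 64 * C₂ * (Λ * u) * (64 * C₂ + 2 * W) := by gcongr
      _ = _ := by ring
  calc _ ≤ 64 * C₂ * Λ * (C₂ * Λ) * u + 16 * C₂ * Λ ^ 2 * u +
        (k.choose 2) * (2048 * C₂ * Λ * u + 64 * C₂ * Λ * (64 * C₂ + 2 * W) * u) := by
        refine (norm_sub_le _ _).trans (add_le_add ?_ ?_)
        · exact (norm_add_le _ _).trans (add_le_add n1 n2)
        · rw [norm_mul, Complex.norm_natCast]
          gcongr
          exact (norm_add_le _ _).trans (add_le_add n3 n4)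
    _ = _ := by ring

theorem exists_eq_linear_of_norm_le {f : ℂ → ℂ} (hf : Differentiable ℂ f) {C : ℝ}
    (hC : ∀ z, ‖f z‖ ≤ C * (1 + ‖z‖)) : ∃ a b : ℂ, ∀ z, f z = a * z + b := by
  have hC0 : 0 ≤ C := by simpa using (norm_nonneg _).trans (hC 0)
  have hd : ∀ z, ‖deriv f z‖ ≤ 4 * C := by
    intro z
    have hr : 0 < 1 + ‖z‖ := by positivity
    have := norm_deriv_le_of_ball (f := f) (z := z) (C := 2 * C * (1 + ‖z‖)) hr
      hf.differentiableOn (fun w hw => (hC w).trans ?_)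
    · refine this.trans (le_of_eq ?_)
      field_simp; ring
    · have h1 : ‖w‖ ≤ ‖z‖ + ‖w - z‖ := by simpa using norm_add_le z (w - z)
      rw [mem_ball_iff_norm] at hw
      nlinarith
  obtain ⟨a, ha⟩ := (Differentiable.exists_const_forall_eq_of_bounded (f := deriv f)
    (hf.contDiff (n := 2)).differentiable_deriv_two
    (isBounded_iff_forall_norm_le.2 ⟨4 * C, by rintro _ ⟨z, rfl⟩; exact hd z⟩))
  refine ⟨a, f 0, fun z => ?_⟩
  have h0 : ∀ w, HasDerivAt (fun w => f w - a * w) 0 w := fun w => by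
    have h1 := (hf w).hasDerivAt.sub ((hasDerivAt_id w).const_mul a)
    refine h1.congr_deriv ?_
    rw [ha w]; simp
  have := is_const_of_deriv_eq_zero (f := fun w => f w - a * w)
    (fun w => (h0 w).differentiableAt) (fun w => (h0 w).deriv) z 0
  simp only [mul_zero, sub_zero] at this
  rw [← this]; ring

theorem exists_eq_exp_of_ne_zero {f : ℂ → ℂ} (hf : Differentiable ℂ f) (h0 : ∀ z, f z ≠ 0) :
    ∃ g : ℂ → ℂ, Differentiable ℂ g ∧ ∀ z, f z = exp (g z) := by
  have hd : Differentiable ℂ (fun w => deriv f w / f w) :=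
    (hf.contDiff (n := 2)).differentiable_deriv_two.div hf h0
  obtain ⟨g, hg⟩ := hd.isExactOn_univ
  have hder : ∀ w, HasDerivAt (fun w => f w * exp (-g w)) 0 w := fun x => by
    have h2 := (hf x).hasDerivAt.mul (hg x (mem_univ x)).neg.cexp
    refine h2.congr_deriv ?_
    field_simp [h0 x]
    simp
  refine ⟨fun w => g w - g 0 + log (f 0), fun w => ?_, fun w => ?_⟩
  · exact ((hg w (mem_univ w)).sub_const (g 0)).add_const (log (f 0)) |>.differentiableAt
  · have := is_const_of_deriv_eq_zero (f := fun w => f w * exp (-g w))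
      (fun w => (hder w).differentiableAt) (fun w => (hder w).deriv) w 0
    rw [exp_add, exp_log (h0 0), exp_sub]
    rw [exp_neg, exp_neg] at this
    field_simp at this ⊢
    linear_combination this

theorem exists_eq_exp_linear {f : ℂ → ℂ} (hf : Differentiable ℂ f) (h0 : ∀ z, f z ≠ 0) {C : ℝ}
    (hC : ∀ z, ‖f z‖ ≤ Real.exp (C * (1 + ‖z‖))) : ∃ a c : ℂ, ∀ z, f z = exp (a * z + c) := by
  obtain ⟨g, hg, hfg⟩ := exists_eq_exp_of_ne_zero hf h0
  set K := max C 1 with hK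
  have hK1 : 1 ≤ K := le_max_right _ _
  have hre : ∀ z, (g z).re ≤ K * (1 + ‖z‖) := fun z => by
    have := hC z
    rw [hfg z, norm_exp, Real.exp_le_exp] at this
    exact this.trans (mul_le_mul_of_nonneg_right (le_max_left _ _) (by positivity))
  obtain ⟨a, c, hac⟩ := exists_eq_linear_of_norm_le hg (C := 6 * K + 3 * ‖g 0‖) (fun z => by
    have hR : 0 < 2 * ‖z‖ + 2 := by positivity
    have hzR : z ∈ ball (0 : ℂ) (2 * ‖z‖ + 2) := by
      rw [mem_ball_zero_iff]; linarith [norm_nonneg z]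
    have := borelCaratheodory (f := g) (M := K * (3 + 2 * ‖z‖)) (by positivity)
      hg.differentiableOn (fun w hw => (hre w).trans (by
        rw [mem_ball_zero_iff] at hw
        exact mul_le_mul_of_nonneg_left (by linarith) (by linarith))) hR hzR
    refine this.trans ?_
    have h2 : 0 < 2 * ‖z‖ + 2 - ‖z‖ := by linarith [norm_nonneg z]
    have e1 : 2 * (K * (3 + 2 * ‖z‖)) * ‖z‖ / (2 * ‖z‖ + 2 - ‖z‖) ≤ 6 * K * (1 + ‖z‖) := by
      rw [div_le_iff₀ h2]
      nlinarith [norm_nonneg z, mul_nonneg (norm_nonneg z) (norm_nonneg z),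
        mul_nonneg (norm_nonneg z) (by linarith : 0 ≤ K),
        mul_nonneg (mul_nonneg (norm_nonneg z) (norm_nonneg z)) (by linarith : 0 ≤ K)]
    have e2 : ‖g 0‖ * (2 * ‖z‖ + 2 + ‖z‖) / (2 * ‖z‖ + 2 - ‖z‖) ≤ 3 * ‖g 0‖ * (1 + ‖z‖) := by
      rw [div_le_iff₀ h2]
      have : 2 * ‖z‖ + 2 + ‖z‖ ≤ 3 * (1 + ‖z‖) * (2 * ‖z‖ + 2 - ‖z‖) := by
        nlinarith [norm_nonneg z]
      nlinarith [mul_le_mul_of_nonneg_left this (norm_nonneg (g 0))]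
    linarith)
  exact ⟨a, c, fun z => by rw [hfg z, hac z]⟩

/-- An entire function of exponential type whose only possible zero is `0`. -/
theorem exists_eq_pow_mul_exp_linear {f : ℂ → ℂ} (hf : Differentiable ℂ f)
    (h0 : ∀ z, f z = 0 → z = 0) {C : ℝ} (hC0 : 0 ≤ C)
    (hC : ∀ z, ‖f z‖ ≤ Real.exp (C * (1 + ‖z‖))) :
    ∃ (q : ℕ) (a c : ℂ), ∀ z, f z = z ^ q * exp (a * z + c) := by
  have han : AnalyticAt ℂ f 0 := hf.analyticAt 0
  obtain ⟨q, g, hg, hg0, hfg⟩ : ∃ (q : ℕ) (g : ℂ → ℂ), AnalyticAt ℂ g 0 ∧ g 0 ≠ 0 ∧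
      ∀ᶠ z in 𝓝 (0 : ℂ), f z = (z - 0) ^ q • g z := by
    refine (han.exists_eventuallyEq_pow_smul_nonzero_iff).2 fun hev => ?_
    have h1 := hev.self_of_nhds
    obtain ⟨ε, hε, hball⟩ := Metric.eventually_nhds_iff.1 hev
    have h2 : f ((ε / 2 : ℝ) : ℂ) = 0 := hball (by
      rw [dist_zero_right, norm_real, Real.norm_of_nonneg (by linarith)]; linarith)
    have h3 := h0 _ h2
    rw [ofReal_eq_zero] at h3
    linarith
  simp only [sub_zero, smul_eq_mul] at hfg
  classical
  set f₁ : ℂ → ℂ := fun z => if z = 0 then g 0 else f z / z ^ q with hf₁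
  have hf₁g : f₁ =ᶠ[𝓝 0] g := by
    filter_upwards [hfg] with z hz
    by_cases h : z = 0
    · simp [hf₁, h]
    · simp only [hf₁, if_neg h, hz]
      field_simp
  have hd₁ : Differentiable ℂ f₁ := by
    intro z
    by_cases h : z = 0
    · subst h
      exact (hf₁g.differentiableAt_iff).2 hg.differentiableAt
    · have : f₁ =ᶠ[𝓝 z] fun z => f z / z ^ q := by
        filter_upwards [isOpen_ne.mem_nhds h] with w hw
        simp [hf₁, show w ≠ 0 from hw]
      exact (this.differentiableAt_iff).2 ((hf z).div (by fun_prop) (pow_ne_zero _ h))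
  have hne : ∀ z, f₁ z ≠ 0 := by
    intro z
    by_cases h : z = 0
    · simpa [hf₁, h] using hg0
    · simp only [hf₁, if_neg h]
      exact div_ne_zero (fun h' => h (h0 z h')) (pow_ne_zero _ h)
  have hbig : ∀ z, 1 ≤ ‖z‖ → ‖f₁ z‖ ≤ Real.exp (C * (1 + ‖z‖)) := by
    intro z hz
    have h : z ≠ 0 := by rintro rfl; simp at hz; linarith
    simp only [hf₁, if_neg h, norm_div, norm_pow]
    exact (div_le_self (norm_nonneg _) (one_le_pow₀ hz)).trans (hC z)
  obtain ⟨a, c, hac⟩ := exists_eq_exp_linear hd₁ hne (C := 2 * C) (fun z => by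
    by_cases hz : 1 ≤ ‖z‖
    · refine (hbig z hz).trans (Real.exp_le_exp.2 ?_)
      nlinarith [norm_nonneg z, mul_nonneg hC0 (norm_nonneg z)]
    · have h1 : ‖f₁ z‖ ≤ Real.exp (C * 2) := by
        refine norm_le_of_forall_mem_frontier_norm_le (U := ball 0 1) isBounded_ball
          hd₁.diffContOnCl (fun w hw => ?_) (subset_closure ?_)
        · rw [frontier_ball _ one_ne_zero, mem_sphere_zero_iff_norm] at hw
          have := hbig w hw.ge
          rw [hw] at this
          exact this.trans (Real.exp_le_exp.2 (by linarith))
        · rw [mem_ball_zero_iff]; exact not_le.1 hz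
      refine h1.trans (Real.exp_le_exp.2 ?_)
      nlinarith [norm_nonneg z, mul_nonneg hC0 (norm_nonneg z)])
  refine ⟨q, a, c, fun z => ?_⟩
  rw [← hac z]
  by_cases h : z = 0
  · subst h
    simp only [hf₁, if_pos]
    exact hfg.self_of_nhds
  · simp only [hf₁, if_neg h]
    field_simp

theorem norm_le_mul_exp_of_dist_lt {H : ℂ → ℂ} (hH : Differentiable ℂ H)
    (hM : ∀ z, ‖deriv H z‖ ≤ 4 * (1 + ‖H z‖ ^ 2)) {A r : ℝ} (hA : 1 ≤ A) {z y : ℂ}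
    (hy : dist y z < r) (hyA : ‖H y‖ ≤ A) : ‖H z‖ ≤ A * Real.exp (16 * A * r) := by
  have := norm_le_exp_of_norm_deriv_le hA hH.differentiableOn (fun w _ => hM w)
    (show y ∈ ball z r from hy) hyA
  refine this.trans (mul_le_mul_of_nonneg_left (Real.exp_le_exp.2 ?_) (by linarith))
  nlinarith

theorem differentiable_riccatiPoly {H : ℂ → ℂ} (hH : Differentiable ℂ H) (j : ℕ) :
    Differentiable ℂ (riccatiPoly H j) :=
  differentiableOn_univ.1 (differentiableOn_riccatiPoly isOpen_univ hH.differentiableOn j)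

theorem exists_norm_le_add_riccatiPoly {H : ℂ → ℂ} (hH : Differentiable ℂ H)
    (hM : ∀ z, ‖deriv H z‖ ≤ 4 * (1 + ‖H z‖ ^ 2)) {k : ℕ} (hk : 1 ≤ k) :
    ∃ D : ℝ, ∀ z, ‖H z‖ ≤ D + 2 * ‖riccatiPoly H k z‖ := by
  obtain ⟨A, hA1, hA⟩ := exists_norm_pow_le_riccatiPoly k one_pos
  refine ⟨A * Real.exp (16 * A * 1) + 1, fun z => ?_⟩
  have hpos : 0 < A * Real.exp (16 * A * 1) := by positivity
  by_cases h : ∀ w ∈ ball z 1, A ≤ ‖H w‖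
  · have h1 := hA H z hH.differentiableOn h
    have h2 : 1 ≤ ‖H z‖ := hA1.trans (h z (mem_ball_self one_pos))
    have h3 := le_self_pow₀ h2 (by omega : k ≠ 0)
    linarith
  · push Not at h
    obtain ⟨y, hy, hyA⟩ := h
    have := norm_le_mul_exp_of_dist_lt hH hM hA1 hy hyA.le
    linarith [norm_nonneg (riccatiPoly H k z)]

theorem exists_le_norm_of_lt_riccatiPoly {H : ℂ → ℂ} (hH : Differentiable ℂ H)
    (hM : ∀ z, ‖deriv H z‖ ≤ 4 * (1 + ‖H z‖ ^ 2)) (k : ℕ) {A : ℝ} (hA : 1 ≤ A) :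
    ∃ B : ℝ, ∀ z, B < ‖riccatiPoly H k z‖ → ∀ w ∈ ball z 1, A ≤ ‖H w‖ := by
  obtain ⟨B, hB⟩ := exists_norm_riccatiPoly_le k (A * Real.exp (16 * A * 2)) one_pos
  refine ⟨B, fun z hz w hw => ?_⟩
  by_contra! hlt
  refine hz.not_ge (hB H z hH.differentiableOn fun x hx =>
    norm_le_mul_exp_of_dist_lt hH hM hA ?_ hlt.le)
  rw [mem_ball] at hw hx
  linarith [dist_triangle_right w x z]

theorem exists_riccatiPoly_le_exp {H : ℂ → ℂ} (hH : Differentiable ℂ H) {C : ℝ} (hC0 : 0 ≤ C)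
    (hC : ∀ z, ‖H z‖ ≤ Real.exp (C * (1 + ‖z‖))) (j : ℕ) :
    ∃ D : ℝ, 0 ≤ D ∧ ∀ z, ‖riccatiPoly H j z‖ ≤ Real.exp (D * (1 + ‖z‖)) := by
  induction j with
  | zero => exact ⟨0, le_rfl, fun z => by simp [riccatiPoly]⟩
  | succ j ih =>
    obtain ⟨D, hD0, hD⟩ := ih
    refine ⟨2 * D + C + 2, by positivity, fun z => ?_⟩
    have h1 := norm_deriv_le_of_ball (z := z) one_pos
      (differentiable_riccatiPoly hH j).differentiableOn
      (C := Real.exp (2 * D * (1 + ‖z‖))) (fun w hw => (hD w).trans (Real.exp_le_exp.2 (by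
        rw [mem_ball_iff_norm] at hw
        have h1 : ‖w‖ ≤ ‖z‖ + ‖w - z‖ := by simpa using norm_add_le z (w - z)
        nlinarith [norm_nonneg z, mul_nonneg hD0 (norm_nonneg z)])))
    have hz : 0 ≤ ‖z‖ := norm_nonneg z
    have e3 : (3 : ℝ) ≤ Real.exp (2 * (1 + ‖z‖)) := by
      linarith [Real.add_one_le_exp (2 * (1 + ‖z‖))]
    set E := Real.exp ((2 * D + C) * (1 + ‖z‖)) with hE
    have hE0 : 0 < E := Real.exp_pos _
    have h2 : Real.exp (2 * D * (1 + ‖z‖)) ≤ E :=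
      Real.exp_le_exp.2 (mul_le_mul_of_nonneg_right (by linarith) (by linarith))
    have h3 : ‖H z * riccatiPoly H j z‖ ≤ E := by
      rw [norm_mul]
      calc _ ≤ Real.exp (C * (1 + ‖z‖)) * Real.exp (D * (1 + ‖z‖)) := by
            gcongr
            exacts [hC z, hD z]
        _ = Real.exp ((C + D) * (1 + ‖z‖)) := by rw [← Real.exp_add]; ring_nf
        _ ≤ E := Real.exp_le_exp.2 (mul_le_mul_of_nonneg_right (by linarith) (by linarith))
    have h4 : Real.exp ((2 * D + C + 2) * (1 + ‖z‖)) = E * Real.exp (2 * (1 + ‖z‖)) := by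
      rw [hE, ← Real.exp_add]; ring_nf
    rw [h4]
    calc ‖riccatiPoly H (j + 1) z‖ ≤ _ := norm_add_le _ _
      _ ≤ 3 * E := by linarith
      _ ≤ _ := by nlinarith

theorem exists_riccati_remainder_le_of_large (k : ℕ) (hk : 1 ≤ k) {W : ℝ} (hW : 0 ≤ W) :
    ∃ A : ℝ, 1 ≤ A ∧ ∃ C : ℝ, 0 ≤ C ∧ ∀ (H w : ℂ → ℂ) (z : ℂ), DifferentiableOn ℂ H (ball z 1) →
      DifferentiableOn ℂ w (ball z 1) → (∀ x ∈ ball z 1, A ≤ ‖H x‖) →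
      (∀ x ∈ ball z 1, ‖w x‖ ≤ W) →
      (∀ x ∈ ball z 1, deriv (riccatiPoly H k) x = w x * riccatiPoly H k x) →
      ‖w z * H z - k * deriv H z +
        (k.choose 2 : ℂ) * ((w z / k) ^ 2 - deriv w z / k)‖ ≤ C / ‖H z‖ := by
  obtain ⟨ε₀, hε₀, C, hC⟩ := exists_norm_riccati_remainder_le k hk hW
  refine ⟨max 1 ε₀⁻¹, le_max_left _ _, |C|, abs_nonneg C, fun H w z hHd hwd hA hwW hode => ?_⟩
  have hz := mem_ball_self (x := z) one_pos
  have hne : ∀ x ∈ ball z 1, H x ≠ 0 := fun x hx h0 => by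
    have := (le_max_left _ _).trans (hA x hx)
    rw [h0, norm_zero] at this
    linarith
  have hHz := hne z hz
  have := hC (fun x => (H x)⁻¹) w z (hHd.inv hne) hwd (fun x hx => inv_ne_zero (hne x hx))
    (fun x hx => by
      rw [norm_inv]
      exact inv_le_of_inv_le₀ hε₀ ((le_max_right _ _).trans (hA x hx))) hwW
    (by simpa only [inv_inv] using hode)
  have hder : deriv (fun x => (H x)⁻¹) z = -deriv H z / H z ^ 2 :=
    ((hHd.differentiableAt (isOpen_ball.mem_nhds hz)).hasDerivAt.inv hHz).deriv
  rw [hder, norm_inv, ← div_eq_mul_inv] at this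
  have e : w z / (H z)⁻¹ + k * (-deriv H z / H z ^ 2) / (H z)⁻¹ ^ 2 =
      w z * H z - k * deriv H z := by
    field_simp
    ring
  rw [e] at this
  exact this.trans (by gcongr; exact le_abs_self C)

theorem exists_riccatiPoly_sub_pow_le (j : ℕ) (A : ℝ) :
    ∃ C : ℝ, 0 ≤ C ∧ ∀ (H : ℂ → ℂ) (z : ℂ) (R : ℝ), 1 ≤ R → DifferentiableOn ℂ H (ball z R) →
      (∀ w ∈ ball z R, ‖H w‖ ≤ A) → ‖riccatiPoly H j z - H z ^ j‖ ≤ C / R := by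
  induction j with
  | zero => exact ⟨0, le_rfl, fun H z R _ _ _ => by simp [riccatiPoly]⟩
  | succ j ih =>
    obtain ⟨C, hC0, hC⟩ := ih
    obtain ⟨B, hB⟩ := exists_norm_riccatiPoly_le j A (r := 1 / 2) (by norm_num)
    refine ⟨4 * |B| + |A| * C, by positivity, fun H z R hR hd hA => ?_⟩
    have hR0 : 0 < R := by linarith
    have h1 := norm_deriv_le_of_ball (z := z) (half_pos hR0) (C := |B|)
      ((differentiableOn_riccatiPoly isOpen_ball hd j).mono (ball_subset_ball (by linarith)))
      (fun w hw => by
        have hsub : ball w (1 / 2) ⊆ ball z R :=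
          (ball_subset_ball (by linarith)).trans (ball_half_subset hw)
        exact (hB H w (hd.mono hsub) fun x hx => hA x (hsub hx)).trans (le_abs_self B))
    have h2 : ‖H z * (riccatiPoly H j z - H z ^ j)‖ ≤ |A| * (C / R) := by
      rw [norm_mul]
      gcongr
      exacts [(hA z (mem_ball_self hR0)).trans (le_abs_self A), hC H z R hR hd hA]
    have e : riccatiPoly H (j + 1) z - H z ^ (j + 1) =
        deriv (riccatiPoly H j) z + H z * (riccatiPoly H j z - H z ^ j) := by
      simp only [riccatiPoly]; ring
    rw [e]
    refine (norm_add_le _ _).trans ((add_le_add h1 h2).trans (le_of_eq ?_))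
    field_simp
    ring

theorem deriv_pow_mul_exp (q : ℕ) (a c : ℂ) {z : ℂ} (hz : z ≠ 0) :
    deriv (fun z => z ^ q * exp (a * z + c)) z = (a + q / z) * (z ^ q * exp (a * z + c)) := by
  have h : HasDerivAt (fun z => z ^ q * exp (a * z + c))
      ((q * z ^ (q - 1)) * exp (a * z + c) + z ^ q * (exp (a * z + c) * a)) z :=
    (hasDerivAt_pow q z).mul ((by
      simpa using ((hasDerivAt_id z).const_mul a).add_const c :
      HasDerivAt (fun z => a * z + c) a z).cexp)
  rw [h.deriv]
  rcases q with _ | q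
  · simp; ring
  · simp only [Nat.add_sub_cancel, pow_succ]
    field_simp
    ring

theorem hasDerivAt_add_div (q a : ℂ) {z : ℂ} (hz : z ≠ 0) :
    HasDerivAt (fun z => a + q / z) (-q / z ^ 2) z := by
  have := ((hasDerivAt_inv hz).const_mul q).const_add a
  simp only [← div_eq_mul_inv] at this
  refine this.congr_deriv ?_
  field_simp

/-- The remainder estimate for `riccatiPoly H k = z ^ q * exp (a * z + c)`, at points near which
`H` is large. -/
theorem exists_remainder_le_of_eq_pow_mul_exp {H : ℂ → ℂ} (hH : Differentiable ℂ H) {k : ℕ}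
    (hk : 1 ≤ k) {q : ℕ} {a c : ℂ} (hv : ∀ z, riccatiPoly H k z = z ^ q * exp (a * z + c)) :
    ∃ A : ℝ, 1 ≤ A ∧ ∃ C : ℝ, 0 ≤ C ∧ ∀ z : ℂ, 2 ≤ ‖z‖ → (∀ x ∈ ball z 1, A ≤ ‖H x‖) →
      ‖(a + q / z) * H z - k * deriv H z +
        (k.choose 2 : ℂ) * (((a + q / z) / k) ^ 2 + q / (k * z ^ 2))‖ ≤ C / ‖H z‖ := by
  obtain ⟨A, hA1, C, hC0, hC⟩ := exists_riccati_remainder_le_of_large k hk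
    (W := ‖a‖ + q) (by positivity)
  refine ⟨A, hA1, C, hC0, fun z hz hlarge => ?_⟩
  have hx1 : ∀ x ∈ ball z 1, 1 ≤ ‖x‖ := fun x hx => by
    rw [mem_ball_iff_norm'] at hx
    linarith [norm_sub_norm_le z x]
  have hx0 : ∀ x ∈ ball z 1, x ≠ 0 := fun x hx h => by
    have := hx1 x hx
    rw [h, norm_zero] at this
    linarith
  have hz0 : z ≠ 0 := hx0 z (mem_ball_self one_pos)
  have := hC H (fun x => a + q / x) z hH.differentiableOn
    (fun x hx => (hasDerivAt_add_div q a (hx0 x hx)).differentiableAt.differentiableWithinAt)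
    hlarge (fun x hx => (norm_add_le _ _).trans (by
      rw [norm_div, norm_natCast]
      gcongr
      exact div_le_self (Nat.cast_nonneg q) (hx1 x hx)))
    (fun x hx => by
      rw [hv x, ← deriv_pow_mul_exp q a c (hx0 x hx)]
      congr 1
      exact funext hv)
  rw [(hasDerivAt_add_div (q : ℂ) a hz0).deriv] at this
  convert this using 4
  field_simp
  ring

theorem exists_linear_of_eq_pow_mul_exp {H : ℂ → ℂ} (hH : Differentiable ℂ H)
    (hM : ∀ z, ‖deriv H z‖ ≤ 4 * (1 + ‖H z‖ ^ 2)) {k : ℕ} (hk : 1 ≤ k) {q : ℕ} {a c : ℂ}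
    (hv : ∀ z, riccatiPoly H k z = z ^ q * exp (a * z + c)) :
    ∃ α β : ℂ, ∀ z, (a * z + q) * H z - k * z * deriv H z = α * z + β := by
  obtain ⟨A, hA1, C, hC0, hC⟩ := exists_remainder_le_of_eq_pow_mul_exp hH hk hv
  have hkR : (1 : ℝ) ≤ k := by exact_mod_cast hk
  have hdH : Differentiable ℂ (deriv H) := (hH.contDiff (n := 2)).differentiable_deriv_two
  set K : ℂ → ℂ := fun z => (a * z + q) * H z - k * z * deriv H z with hK
  have hKd : Differentiable ℂ K := by fun_prop
  obtain ⟨B₀, hB₀⟩ := (isCompact_closedBall (0 : ℂ) 2).exists_bound_of_continuousOn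
    hKd.continuous.continuousOn
  set A' := A * Real.exp (16 * A * 1) with hA'
  have hA'0 : 0 ≤ A' := by positivity
  set W := ‖a‖ + q with hW
  have hW0 : 0 ≤ W := by positivity
  set B₁ := C + (k.choose 2) * (W ^ 2 + q) with hB₁
  set B₂ := W * A' + k * (4 * (1 + A' ^ 2)) with hB₂
  have hB₁0 : 0 ≤ B₁ := by positivity
  have hB₂0 : 0 ≤ B₂ := by positivity
  refine exists_eq_linear_of_norm_le hKd (C := |B₀| + B₁ + B₂) fun z => ?_
  have hn := norm_nonneg z
  have habs := abs_nonneg B₀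
  by_cases hz : ‖z‖ ≤ 2
  · have := (hB₀ z (mem_closedBall_zero_iff.2 hz)).trans (le_abs_self B₀)
    nlinarith [mul_nonneg habs hn, mul_nonneg hB₁0 hn, mul_nonneg hB₂0 hn]
  · push Not at hz
    have hz0 : z ≠ 0 := norm_pos_iff.1 (by linarith)
    have hKz : K z = z * ((a + q / z) * H z - k * deriv H z) := by
      simp only [hK]; field_simp
    have hwW : ‖a + q / z‖ ≤ W := (norm_add_le _ _).trans (by
      rw [norm_div, Complex.norm_natCast]
      exact add_le_add le_rfl (div_le_self (Nat.cast_nonneg q) (by linarith)))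
    have main : ‖(a + q / z) * H z - k * deriv H z‖ ≤ B₁ + B₂ := by
      by_cases hlarge : ∀ x ∈ ball z 1, A ≤ ‖H x‖
      · have h1 := hC z hz.le hlarge
        have hHz : 1 ≤ ‖H z‖ := hA1.trans (hlarge z (mem_ball_self one_pos))
        have h2 : C / ‖H z‖ ≤ C := div_le_self hC0 hHz
        have h3 : ‖(k.choose 2 : ℂ) * (((a + q / z) / k) ^ 2 + q / (k * z ^ 2))‖ ≤
            (k.choose 2) * (W ^ 2 + q) := by
          rw [norm_mul, Complex.norm_natCast]
          gcongr
          refine (norm_add_le _ _).trans ?_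
          rw [norm_pow, norm_div, norm_div, norm_mul, Complex.norm_natCast, Complex.norm_natCast,
            norm_pow]
          gcongr
          · exact (div_le_self (norm_nonneg _) hkR).trans hwW
          · exact div_le_self (Nat.cast_nonneg q) (by nlinarith)
        have h4 := norm_sub_le ((a + q / z) * H z - k * deriv H z +
          (k.choose 2 : ℂ) * (((a + q / z) / k) ^ 2 + q / (k * z ^ 2)))
          ((k.choose 2 : ℂ) * (((a + q / z) / k) ^ 2 + q / (k * z ^ 2)))
        rw [add_sub_cancel_right] at h4
        linarith
      · push Not at hlarge
        obtain ⟨y, hy, hyA⟩ := hlarge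
        have h1 : ‖H z‖ ≤ A' := norm_le_mul_exp_of_dist_lt hH hM hA1 hy hyA.le
        have h2 : ‖(a + q / z) * H z - k * deriv H z‖ ≤ B₂ := by
          refine (norm_sub_le _ _).trans ?_
          rw [norm_mul, norm_mul, Complex.norm_natCast]
          have h3 : ‖deriv H z‖ ≤ 4 * (1 + A' ^ 2) := (hM z).trans (by gcongr)
          exact add_le_add (mul_le_mul hwW h1 (norm_nonneg _) hW0)
            (mul_le_mul_of_nonneg_left h3 (Nat.cast_nonneg k))
        linarith
    change ‖K z‖ ≤ _
    rw [hKz, norm_mul]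
    nlinarith [mul_le_mul_of_nonneg_left main hn, mul_nonneg habs hn]

theorem tendsto_norm_atTop_of_riccatiPoly {H : ℂ → ℂ} (hH : Differentiable ℂ H)
    (hM : ∀ z, ‖deriv H z‖ ≤ 4 * (1 + ‖H z‖ ^ 2)) {k : ℕ} {p : ℝ → ℂ}
    (hp : Tendsto (fun t => ‖riccatiPoly H k (p t)‖) atTop atTop) :
    Tendsto (fun t => ‖H (p t)‖) atTop atTop := by
  refine tendsto_atTop.2 fun A => ?_
  obtain ⟨B, hB⟩ := exists_le_norm_of_lt_riccatiPoly hH hM k (le_max_left 1 A)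
  filter_upwards [hp.eventually_gt_atTop B] with t ht
  exact (le_max_right 1 A).trans (hB _ ht _ (mem_ball_self one_pos))

theorem norm_pow_mul_exp_linear (q : ℕ) (a c z : ℂ) :
    ‖z ^ q * exp (a * z + c)‖ = ‖z‖ ^ q * Real.exp ((a * z).re + c.re) := by
  rw [norm_mul, norm_pow, norm_exp, add_re]

/-- The exponential rate of `riccatiPoly H k` vanishes. -/
theorem rate_eq_zero_of_eq_pow_mul_exp {H : ℂ → ℂ} (hH : Differentiable ℂ H)
    (hM : ∀ z, ‖deriv H z‖ ≤ 4 * (1 + ‖H z‖ ^ 2)) {k : ℕ} (hk : 2 ≤ k) {q : ℕ} {a c : ℂ}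
    (hv : ∀ z, riccatiPoly H k z = z ^ q * exp (a * z + c)) : a = 0 := by
  by_contra ha
  have ha0 : 0 < ‖a‖ := norm_pos_iff.2 ha
  obtain ⟨α, β, hK⟩ := exists_linear_of_eq_pow_mul_exp hH hM (by omega) hv
  obtain ⟨A, hA1, C, hC0, hC⟩ := exists_remainder_le_of_eq_pow_mul_exp hH (by omega) hv
  have hk0 : (k : ℂ) ≠ 0 := by exact_mod_cast (by omega : k ≠ 0)
  have hK' : ∀ z, z ≠ 0 → (a + q / z) * H z - k * deriv H z = α + β / z := fun z hz => by
    have := hK z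
    field_simp
    linear_combination this
  -- the ray on which `riccatiPoly H k` is large
  have hnorm : ∀ t : ℝ, 0 < t → ‖(t : ℂ) * (starRingEnd ℂ) a‖ = t * ‖a‖ := fun t ht => by
    rw [norm_mul, norm_real, norm_conj, Real.norm_of_nonneg ht.le]
  have hre : ∀ t : ℝ, (a * ((t : ℂ) * (starRingEnd ℂ) a)).re = t * ‖a‖ ^ 2 := fun t => by
    rw [mul_left_comm, mul_conj, re_ofReal_mul, ofReal_re, normSq_eq_norm_sq]
  have hinf : Tendsto (fun t : ℝ => t * ‖a‖) atTop atTop := tendsto_id.atTop_mul_const ha0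
  have hcob : Tendsto (fun t : ℝ => ‖(t : ℂ) * (starRingEnd ℂ) a‖) atTop atTop :=
    hinf.congr' (by filter_upwards [eventually_gt_atTop 0] with t ht using (hnorm t ht).symm)
  have hinv : Tendsto (fun t : ℝ => ((t : ℂ) * (starRingEnd ℂ) a)⁻¹) atTop (𝓝 0) :=
    tendsto_inv₀_cobounded.comp (tendsto_norm_atTop_iff_cobounded.1 hcob)
  have hα : α + (k.choose 2 : ℂ) * (a / k) ^ 2 = 0 := by
    set p : ℝ → ℂ := fun t => (t : ℂ) * (starRingEnd ℂ) a with hp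
    have hvp : Tendsto (fun t => ‖riccatiPoly H k (p t)‖) atTop atTop := by
      have h1 : Tendsto (fun t : ℝ => Real.exp (t * ‖a‖ ^ 2 + c.re)) atTop atTop :=
        Real.tendsto_exp_atTop.comp
          (tendsto_atTop_add_const_right _ _ (tendsto_id.atTop_mul_const (by positivity)))
      refine tendsto_atTop_mono' _ ?_ h1
      filter_upwards [hcob.eventually_ge_atTop 1] with t ht
      rw [hv, norm_pow_mul_exp_linear, hre]
      exact le_mul_of_one_le_left (Real.exp_pos _).le (one_le_pow₀ ht)
    have hHp := tendsto_norm_atTop_of_riccatiPoly hH hM hvp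
    obtain ⟨B, hB⟩ := exists_le_norm_of_lt_riccatiPoly hH hM k hA1
    have h1 : Tendsto (fun t => (α + β * (p t)⁻¹) + (k.choose 2 : ℂ) *
        (((a + q * (p t)⁻¹) / k) ^ 2 + q / k * (p t)⁻¹ ^ 2)) atTop
        (𝓝 ((α + β * 0) + (k.choose 2 : ℂ) * (((a + q * 0) / k) ^ 2 + q / k * 0 ^ 2))) :=
      ((hinv.const_mul β).const_add α).add
        ((((((hinv.const_mul (q : ℂ)).const_add a).div_const _).pow 2).add
          ((hinv.pow 2).const_mul _)).const_mul _)
    have h2 : Tendsto (fun t => (α + β * (p t)⁻¹) + (k.choose 2 : ℂ) *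
        (((a + q * (p t)⁻¹) / k) ^ 2 + q / k * (p t)⁻¹ ^ 2)) atTop (𝓝 0) := by
      refine squeeze_zero_norm' ?_ (hHp.const_div_atTop C)
      filter_upwards [hvp.eventually_gt_atTop B, hcob.eventually_ge_atTop 2] with t ht1 ht2
      have hne : p t ≠ 0 := norm_pos_iff.1 (by linarith [show 2 ≤ ‖p t‖ from ht2])
      have := hC (p t) ht2 (hB _ ht1)
      rw [hK' _ hne] at this
      refine le_trans (le_of_eq ?_) this
      congr 1
      field_simp
    simpa using tendsto_nhds_unique h1 h2
  -- the ray on which it is small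
  have hα0 : α = 0 := by
    set p : ℝ → ℂ := fun t => -((t : ℂ) * (starRingEnd ℂ) a) with hp
    have hinv' : Tendsto (fun t => (p t)⁻¹) atTop (𝓝 0) := by
      simpa [hp, inv_neg] using hinv.neg
    set φ : ℝ → ℝ := fun t => (2 * (t * ‖a‖)) ^ q * Real.exp (-(t * ‖a‖ ^ 2 / 2) + c.re) with hφ
    have hφ0 : Tendsto φ atTop (𝓝 0) := by
      have h1 : Tendsto (fun t : ℝ => t * ‖a‖ ^ 2 / 2) atTop atTop :=
        (tendsto_id.atTop_mul_const (by positivity : 0 < ‖a‖ ^ 2)).atTop_div_const two_pos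
      have h2 := ((Real.tendsto_pow_mul_exp_neg_atTop_nhds_zero q).comp h1).const_mul
        ((4 / ‖a‖) ^ q * Real.exp c.re)
      rw [mul_zero] at h2
      refine h2.congr fun t => ?_
      simp only [hφ, Function.comp, Real.exp_add]
      rw [show 2 * (t * ‖a‖) = 4 / ‖a‖ * (t * ‖a‖ ^ 2 / 2) by field_simp; ring, mul_pow]
      ring
    have hball : ∀ t : ℝ, 0 < t → ∀ x ∈ ball (p t) (t * ‖a‖ / 2), ‖riccatiPoly H k x‖ ≤ φ t := by
      intro t ht x hx
      rw [mem_ball_iff_norm] at hx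
      have hxn : ‖x‖ ≤ 2 * (t * ‖a‖) := by
        have h1 : ‖x‖ ≤ ‖p t‖ + ‖x - p t‖ := by simpa using norm_add_le (p t) (x - p t)
        rw [hp, norm_neg, hnorm t ht] at h1
        linarith [mul_pos ht ha0]
      have hxr : (a * x).re ≤ -(t * ‖a‖ ^ 2 / 2) := by
        have e : (a * x).re = -(t * ‖a‖ ^ 2) + (a * (x - p t)).re := by
          rw [← hre t, ← neg_re, ← add_re]
          congr 1
          simp only [hp]; ring
        have h1 := (re_le_norm (a * (x - p t)))
        rw [norm_mul] at h1
        have h2 := mul_le_mul_of_nonneg_left hx.le ha0.le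
        rw [e]
        nlinarith
      rw [hv, norm_pow_mul_exp_linear]
      simp only [hφ]
      gcongr
    obtain ⟨D, hD⟩ := exists_norm_le_add_riccatiPoly hH hM (k := k) (by omega)
    have hsmall : ∀ᶠ t : ℝ in atTop, 0 < t ∧ ∀ x ∈ ball (p t) (t * ‖a‖ / 2), ‖H x‖ ≤ D + 2 := by
      filter_upwards [eventually_gt_atTop 0, hφ0.eventually (eventually_le_nhds one_pos)]
        with t ht ht1
      exact ⟨ht, fun x hx => (hD x).trans (by linarith [hball t ht x hx])⟩
    have hRinf : Tendsto (fun t : ℝ => t * ‖a‖ / 2) atTop atTop := hinf.atTop_div_const two_pos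
    have hder : Tendsto (fun t => deriv H (p t)) atTop (𝓝 0) := by
      refine squeeze_zero_norm' ?_ (hRinf.const_div_atTop (2 * (D + 2)))
      filter_upwards [hsmall] with t ht
      exact norm_deriv_le_of_ball (by have := ht.1; positivity) hH.differentiableOn ht.2
    obtain ⟨E, hE0, hE⟩ := exists_riccatiPoly_sub_pow_le k (D + 2)
    have hpow : Tendsto (fun t => ‖H (p t)‖ ^ k) atTop (𝓝 0) := by
      have h0 : Tendsto (fun t => φ t + E / (t * ‖a‖ / 2)) atTop (𝓝 0) := by
        simpa using hφ0.add (hRinf.const_div_atTop E)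
      refine squeeze_zero' (Eventually.of_forall fun t => by positivity) ?_ h0
      filter_upwards [hsmall, hRinf.eventually_ge_atTop 1] with t ht ht1
      have h1 := hE H (p t) _ ht1 hH.differentiableOn ht.2
      have h2 := hball t ht.1 (p t) (mem_ball_self (by linarith))
      have h3 := norm_sub_norm_le (H (p t) ^ k) (riccatiPoly H k (p t))
      rw [norm_pow, norm_sub_rev] at h3
      linarith
    have hH0 : Tendsto (fun t => H (p t)) atTop (𝓝 0) := by
      rw [tendsto_zero_iff_norm_tendsto_zero]
      have h1 := hpow.rpow_const (p := ((k : ℝ)⁻¹)) (Or.inr (by positivity))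
      rw [Real.zero_rpow (by simp; omega)] at h1
      exact h1.congr fun t => Real.pow_rpow_inv_natCast (norm_nonneg _) (by omega)
    have h1 : Tendsto (fun t => (a + q * (p t)⁻¹) * H (p t) - k * deriv H (p t)) atTop
        (𝓝 ((a + q * 0) * 0 - k * 0)) :=
      (((hinv'.const_mul (q : ℂ)).const_add a).mul hH0).sub (hder.const_mul _)
    have h2 : Tendsto (fun t => (a + q * (p t)⁻¹) * H (p t) - k * deriv H (p t)) atTop
        (𝓝 (α + β * 0)) := by
      refine ((hinv'.const_mul β).const_add α).congr' ?_
      filter_upwards [eventually_gt_atTop 0] with t ht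
      have hne : p t ≠ 0 := by
        rw [← norm_pos_iff, hp, norm_neg, hnorm t ht]; positivity
      rw [← div_eq_mul_inv, ← div_eq_mul_inv, hK' _ hne]
    simpa using (tendsto_nhds_unique h1 h2).symm
  rw [hα0, zero_add] at hα
  have hch : (k.choose 2 : ℂ) ≠ 0 := by exact_mod_cast (Nat.choose_pos hk).ne'
  exact (mul_ne_zero hch (pow_ne_zero 2 (div_ne_zero ha hk0))) hα

/-- A quadratic polynomial tending to `0` along the positive reals vanishes. -/
theorem eq_zero_of_tendsto_quadratic {α β γ : ℂ}
    (h : Tendsto (fun t : ℝ => α * (t : ℂ) ^ 2 + β * t + γ) atTop (𝓝 0)) : γ = 0 := by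
  have h1 := h.comp (tendsto_atTop_add_const_right atTop (1 : ℝ) tendsto_id)
  have h2 := h.comp (tendsto_atTop_add_const_right atTop (2 : ℝ) tendsto_id)
  have hα : α = 0 := by
    have h3 := (h2.sub (h1.const_mul 2)).add h
    have h4 : Tendsto (fun _ : ℝ => 2 * α) atTop (𝓝 (0 - 2 * 0 + 0)) :=
      h3.congr fun t => by simp; ring
    simpa using (tendsto_nhds_unique h4 tendsto_const_nhds).symm
  subst hα
  have hβ : β = 0 := by
    have h4 : Tendsto (fun _ : ℝ => β) atTop (𝓝 (0 - 0)) :=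
      (h1.sub h).congr fun t => by simp; ring
    simpa using (tendsto_nhds_unique h4 tendsto_const_nhds).symm
  subst hβ
  simp only [zero_mul, zero_add] at h
  exact tendsto_nhds_unique tendsto_const_nhds h

theorem exponent_eq_zero_of_eq_pow_mul_exp {H : ℂ → ℂ} (hH : Differentiable ℂ H)
    (hM : ∀ z, ‖deriv H z‖ ≤ 4 * (1 + ‖H z‖ ^ 2)) {k : ℕ} (hk : 2 ≤ k) {q : ℕ} {c : ℂ}
    (hv : ∀ z, riccatiPoly H k z = z ^ q * exp (0 * z + c)) : q = 0 := by
  by_contra hq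
  have hq1 : 1 ≤ q := Nat.one_le_iff_ne_zero.2 hq
  obtain ⟨α, β, hK⟩ := exists_linear_of_eq_pow_mul_exp hH hM (by omega) hv
  obtain ⟨A, hA1, C, hC0, hC⟩ := exists_riccati_remainder_le_of_large k (by omega)
    (W := q) (by positivity)
  obtain ⟨B, hB⟩ := exists_le_norm_of_lt_riccatiPoly hH hM k hA1
  have hk0 : (k : ℂ) ≠ 0 := by exact_mod_cast (by omega : k ≠ 0)
  have hec : 0 < Real.exp c.re := Real.exp_pos _
  set γ : ℂ := (k.choose 2 : ℂ) * ((q / (2 * k)) ^ 2 + q / (4 * k)) with hγ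
  have hlim : Tendsto (fun t : ℝ => α * (t : ℂ) ^ 2 + (β / 2) * t + γ) atTop (𝓝 0) := by
    refine squeeze_zero_norm' ?_ (tendsto_id.const_div_atTop C)
    filter_upwards [eventually_ge_atTop 1, eventually_gt_atTop (B / Real.exp c.re)] with t ht ht1
    have ht0 : 0 < t := by linarith
    have htc : (t : ℂ) ≠ 0 := ofReal_ne_zero.2 ht0.ne'
    rw [div_lt_iff₀ hec] at ht1
    have hlarge : ∀ x : ℂ, t ≤ ‖x‖ → A ≤ ‖H x‖ := fun x hx => by
      refine hB x (ht1.trans_le ?_) x (mem_ball_self one_pos)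
      rw [hv, norm_pow_mul_exp_linear, zero_mul, zero_re, zero_add]
      gcongr
      exact hx.trans (le_self_pow₀ (ht.trans hx) hq)
    have hx1 : ∀ x ∈ ball (2 : ℂ) 1, 1 ≤ ‖x‖ := fun x hx => by
      rw [mem_ball_iff_norm'] at hx
      have := norm_sub_norm_le (2 : ℂ) x
      rw [Complex.norm_ofNat] at this
      linarith
    have hx0 : ∀ x ∈ ball (2 : ℂ) 1, x ≠ 0 := fun x hx h => by
      have := hx1 x hx
      rw [h, norm_zero] at this
      linarith
    have htx : ∀ x ∈ ball (2 : ℂ) 1, A ≤ ‖H (0 + t * x)‖ := fun x hx => hlarge _ (by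
      rw [zero_add, norm_mul, norm_real, Real.norm_of_nonneg ht0.le]
      exact le_mul_of_one_le_right ht0.le (hx1 x hx))
    have hnt : ∀ x, ‖(t : ℂ) * H (0 + t * x)‖ = t * ‖H (0 + t * x)‖ := fun x => by
      rw [norm_mul, norm_real, Real.norm_of_nonneg ht0.le]
    have hHder : ∀ x, HasDerivAt (fun x => (t : ℂ) * H (0 + t * x))
        (t * (deriv H (0 + t * x) * t)) x := fun x => by
      have h1 : HasDerivAt (fun x : ℂ => 0 + (t : ℂ) * x) t x := by
        simpa using ((hasDerivAt_id x).const_mul (t : ℂ)).const_add 0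
      exact ((hH _).hasDerivAt.comp x h1).const_mul _
    have hP : ∀ x, riccatiPoly (fun x => (t : ℂ) * H (0 + t * x)) k x =
        (t : ℂ) ^ (k + q) * (x ^ q * exp (0 * x + c)) := fun x => by
      rw [riccatiPoly_scale, hv]
      simp only [zero_mul, zero_add, mul_pow, pow_add]
      ring
    have key := hC (fun x => (t : ℂ) * H (0 + t * x)) (fun x => 0 + q / x) 2
      (fun x _ => (hHder x).differentiableAt.differentiableWithinAt)
      (fun x hx =>
        (hasDerivAt_add_div (q : ℂ) 0 (hx0 x hx)).differentiableAt.differentiableWithinAt)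
      (fun x hx => by
        rw [hnt]
        exact (htx x hx).trans (le_mul_of_one_le_left (norm_nonneg _) ht))
      (fun x hx => by
        rw [zero_add, norm_div, Complex.norm_natCast]
        exact div_le_self (Nat.cast_nonneg q) (hx1 x hx))
      (fun x hx => by
        have e : riccatiPoly (fun x => (t : ℂ) * H (0 + t * x)) k =
          fun x => (t : ℂ) ^ (k + q) * (x ^ q * exp (0 * x + c)) := funext hP
        rw [e, deriv_const_mul _ (by fun_prop), deriv_pow_mul_exp q 0 c (hx0 x hx)]
        ring)
    rw [(hasDerivAt_add_div (q : ℂ) 0 two_ne_zero).deriv, (hHder 2).deriv, hnt] at key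
    refine le_trans (le_of_eq ?_) (key.trans ?_)
    · congr 1
      have hK2 := hK (0 + t * 2)
      simp only [zero_mul, zero_add] at hK2 ⊢
      rw [hγ]
      have e2 : α * (t : ℂ) ^ 2 + β / 2 * t = (q : ℂ) / 2 * (t * H (t * 2)) -
          k * (t * (deriv H (t * 2) * t)) := by
        linear_combination (-(t : ℂ) / 2) * hK2
      rw [e2]
      field_simp
      ring
    · apply div_le_div_of_nonneg_left hC0 ht0
      exact le_mul_of_one_le_right ht0.le (hA1.trans (htx 2 (mem_ball_self one_pos)))
  have hγ0 := eq_zero_of_tendsto_quadratic hlim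
  have hpos : 0 < ((k.choose 2 : ℝ)) * ((q / (2 * k)) ^ 2 + q / (4 * k)) := by
    have h1 : (0 : ℝ) < k.choose 2 := by exact_mod_cast Nat.choose_pos hk
    have h2 : (0 : ℝ) < q := by exact_mod_cast hq1
    have h3 : (0 : ℝ) < k := by exact_mod_cast (by omega : 0 < k)
    positivity
  have : ((((k.choose 2 : ℝ)) * ((q / (2 * k)) ^ 2 + q / (4 * k)) : ℝ) : ℂ) = 0 := by
    rw [← hγ0, hγ]; push_cast; ring
  rw [ofReal_eq_zero] at this
  linarith

theorem deriv_eq_zero_of_norm_le {H : ℂ → ℂ} (hH : Differentiable ℂ H) {B : ℝ}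
    (hB : ∀ z, ‖H z‖ ≤ B) (z : ℂ) : deriv H z = 0 := by
  obtain ⟨a, ha⟩ := hH.exists_const_forall_eq_of_bounded
    (isBounded_iff_forall_norm_le.2 ⟨B, by rintro _ ⟨z, rfl⟩; exact hB z⟩)
  rw [show H = fun _ => a from funext ha]
  exact deriv_const z a

/-- An entire function of bounded spherical derivative is constant if the associated Riccati
polynomial of order `k ≥ 2` vanishes identically or has at most one zero. -/
theorem deriv_eq_zero_of_riccatiPoly {H : ℂ → ℂ} (hH : Differentiable ℂ H)
    (hM : ∀ z, ‖deriv H z‖ ≤ 4 * (1 + ‖H z‖ ^ 2)) {C : ℝ} (hC0 : 0 ≤ C)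
    (hC : ∀ z, ‖H z‖ ≤ Real.exp (C * (1 + ‖z‖))) {k : ℕ} (hk : 2 ≤ k)
    (hz : (∀ z, riccatiPoly H k z = 0) ∨
      ∀ z w, riccatiPoly H k z = 0 → riccatiPoly H k w = 0 → z = w) (z : ℂ) :
    deriv H z = 0 := by
  obtain ⟨D, hD⟩ := exists_norm_le_add_riccatiPoly hH hM (k := k) (by omega)
  rcases hz with hz | hz
  · exact deriv_eq_zero_of_norm_le hH (B := D) (fun w => by simpa [hz w] using hD w) z
  obtain ⟨p, hp⟩ : ∃ p, ∀ w, riccatiPoly H k w = 0 → w = p := by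
    by_cases h : ∃ p, riccatiPoly H k p = 0
    · obtain ⟨p, hp⟩ := h
      exact ⟨p, fun w hw => hz w p hw hp⟩
    · push Not at h
      exact ⟨0, fun w hw => absurd hw (h w)⟩
  set G : ℂ → ℂ := fun w => H (p + w) with hG
  have hGd : Differentiable ℂ G := by fun_prop
  have hGder : ∀ w, deriv G w = deriv H (p + w) := fun w => deriv_comp_const_add ..
  have hGP : ∀ w, riccatiPoly G k w = riccatiPoly H k (p + w) := fun w => by
    simpa using riccatiPoly_scale H p 1 k w
  have hGM : ∀ w, ‖deriv G w‖ ≤ 4 * (1 + ‖G w‖ ^ 2) := fun w => by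
    rw [hGder]; exact hM _
  obtain ⟨E, hE0, hE⟩ := exists_riccatiPoly_le_exp hGd (C := C * (1 + ‖p‖)) (by positivity)
    (fun w => (hC _).trans (Real.exp_le_exp.2 (by
      rw [mul_assoc]
      gcongr
      nlinarith [norm_add_le p w, mul_nonneg (norm_nonneg p) (norm_nonneg w)]))) k
  obtain ⟨q, a, c, hv⟩ := exists_eq_pow_mul_exp_linear (differentiable_riccatiPoly hGd k)
    (fun w hw => by
      rw [hGP] at hw
      simpa using hp _ hw) hE0 hE
  have ha := rate_eq_zero_of_eq_pow_mul_exp hGd hGM hk hv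
  subst ha
  have hq := exponent_eq_zero_of_eq_pow_mul_exp hGd hGM hk hv
  subst hq
  refine deriv_eq_zero_of_norm_le hH (B := D + 2 * ‖exp c‖) (fun w => ?_) z
  have h1 := hv (w - p)
  rw [hGP, add_sub_cancel, pow_zero, one_mul, zero_mul, zero_add] at h1
  rw [← h1]
  exact hD w

theorem exists_forall_norm_le_of_eventually {E : Type*} [NormedAddCommGroup E] {u : ℕ → E} {B : ℝ}
    (h : ∀ᶠ n in atTop, ‖u n‖ ≤ B) : ∃ B', ∀ n, ‖u n‖ ≤ B' := by
  obtain ⟨N, hN⟩ := eventually_atTop.1 h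
  obtain ⟨M, hM⟩ := ((Finset.range N).image fun n => ‖u n‖).bddAbove
  refine ⟨max M B, fun n => ?_⟩
  by_cases hn : n < N
  · exact (hM (by simpa using ⟨n, hn, rfl⟩)).trans (le_max_left _ _)
  · exact (hN n (not_lt.1 hn)).trans (le_max_right _ _)

/-- Sequential Arzelà–Ascoli theorem for eventually locally bounded and locally Lipschitz
sequences. -/
theorem exists_subseq_tendstoLocallyUniformlyOn_of_lipschitz {E : Type*} [NormedAddCommGroup E]
    [ProperSpace E] {U : Set ℂ} (F : ℕ → ℂ → E)
    (hF : ∀ x ∈ U, ∃ s > 0, ball x s ⊆ U ∧ ∃ B L : ℝ, ∀ᶠ n in atTop, ∀ y ∈ ball x s,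
      ‖F n y‖ ≤ B ∧ ∀ y' ∈ ball x s, dist (F n y) (F n y') ≤ L * dist y y') :
    ∃ φ : ℕ → ℕ, StrictMono φ ∧ ∃ g : ℂ → E,
      TendstoLocallyUniformlyOn (fun n => F (φ n)) g atTop U := by
  classical
  set d := TopologicalSpace.denseSeq ℂ with hd
  set G : ℕ → ℕ → E := fun n i => if d i ∈ U then F n (d i) else 0 with hG
  have hbd : ∀ i, ∃ B, ∀ n, ‖G n i‖ ≤ B := fun i => by
    by_cases hi : d i ∈ U
    · obtain ⟨s, hs, -, B, L, h⟩ := hF _ hi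
      refine exists_forall_norm_le_of_eventually (B := B) ?_
      filter_upwards [h] with n hn
      simpa [hG, hi] using (hn _ (mem_ball_self hs)).1
    · exact ⟨0, fun n => by simp [hG, hi]⟩
  choose B hB using hbd
  obtain ⟨a, -, φ, hφ, ha⟩ :=
    (isCompact_univ_pi fun i => isCompact_closedBall (0 : E) (B i)).tendsto_subseq
    (x := G) (fun n i _ => mem_closedBall_zero_iff.2 (hB i n))
  have hpt : ∀ i, d i ∈ U → Tendsto (fun n => F (φ n) (d i)) atTop (𝓝 (a i)) := fun i hi => by
    have := (tendsto_pi_nhds.1 ha) i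
    simpa [hG, hi] using this
  have hunif : ∀ x ∈ U, ∀ ε > 0, ∃ δ > 0, ball x δ ⊆ U ∧ ∃ N, ∀ n ≥ N, ∀ m ≥ N,
      ∀ y ∈ ball x δ, dist (F (φ n) y) (F (φ m) y) ≤ ε := by
    intro x hx ε hε
    obtain ⟨s, hs, hsU, C, L, h⟩ := hF x hx
    set L' := max L 1 with hL'
    have hL'1 : 1 ≤ L' := le_max_right _ _
    obtain ⟨i, hi⟩ := (TopologicalSpace.denseRange_denseSeq ℂ).exists_mem_open isOpen_ball
      ⟨x, mem_ball_self (lt_min hs (by positivity : 0 < ε / (8 * L')))⟩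
    have hsub := ball_subset_ball (x := x) (min_le_left s (ε / (8 * L')))
    obtain ⟨N₁, hN₁⟩ := eventually_atTop.1 (hφ.tendsto_atTop.eventually h)
    obtain ⟨N₂, hN₂⟩ := Metric.cauchySeq_iff.1 (hpt i (hsU (hsub hi))).cauchySeq (ε / 2)
      (by positivity)
    refine ⟨_, lt_min hs (by positivity : 0 < ε / (8 * L')), hsub.trans hsU, max N₁ N₂,
      fun n hn m hm y hy => ?_⟩
    have key : ∀ n ≥ max N₁ N₂, dist (F (φ n) y) (F (φ n) (d i)) ≤ ε / 4 := fun n hn => by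
      refine ((hN₁ n ((le_max_left _ _).trans hn) y (hsub hy)).2 _ (hsub hi)).trans ?_
      have h1 : dist y (d i) ≤ 2 * (ε / (8 * L')) := by
        have h2 := (mem_ball.1 hy).trans_le (min_le_right _ _)
        have h3 := (mem_ball.1 hi).trans_le (min_le_right _ _)
        linarith [dist_triangle_right y (d i) x]
      calc L * dist y (d i) ≤ L' * (2 * (ε / (8 * L'))) :=
            mul_le_mul (le_max_left _ _) h1 dist_nonneg (by linarith)
        _ = ε / 4 := by field_simp; norm_num
    have h1 := key n hn
    have h2 := key m hm
    have h3 := hN₂ n ((le_max_right _ _).trans hn) m ((le_max_right _ _).trans hm)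
    rw [dist_comm] at h2
    linarith [dist_triangle4 (F (φ n) y) (F (φ n) (d i)) (F (φ m) (d i)) (F (φ m) y)]
  have hlim : ∀ x, ∃ l, x ∈ U → Tendsto (fun n => F (φ n) x) atTop (𝓝 l) := fun x => by
    by_cases hx : x ∈ U
    · have hc : CauchySeq fun n => F (φ n) x := Metric.cauchySeq_iff.2 fun ε hε => by
        obtain ⟨δ, hδ, -, N, hN⟩ := hunif x hx (ε / 2) (half_pos hε)
        exact ⟨N, fun n hn m hm => (hN n hn m hm x (mem_ball_self hδ)).trans_lt (half_lt_self hε)⟩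
      obtain ⟨l, hl⟩ := cauchySeq_tendsto_of_complete hc
      exact ⟨l, fun _ => hl⟩
    · exact ⟨0, fun h => absurd h hx⟩
  choose g hg using hlim
  refine ⟨φ, hφ, g, Metric.tendstoLocallyUniformlyOn_iff.2 fun ε hε x hx => ?_⟩
  obtain ⟨δ, hδ, hδU, N, hN⟩ := hunif x hx (ε / 2) (half_pos hε)
  refine ⟨ball x δ, mem_nhdsWithin_of_mem_nhds (ball_mem_nhds x hδ), ?_⟩
  filter_upwards [eventually_ge_atTop N] with n hn y hy
  have : dist (g y) (F (φ n) y) ≤ ε / 2 :=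
    le_of_tendsto ((hg y (hδU hy)).dist tendsto_const_nhds) (by
      filter_upwards [eventually_ge_atTop N] with m hm using hN m hm n hn y hy)
  linarith

theorem dist_le_of_norm_le_on_ball {f : ℂ → ℂ} {x : ℂ} {s B : ℝ} (hs : 0 < s)
    (hf : DifferentiableOn ℂ f (ball x s)) (hB : ∀ y ∈ ball x s, ‖f y‖ ≤ B) :
    ∀ y ∈ ball x (s / 2), ∀ y' ∈ ball x (s / 2), dist (f y) (f y') ≤ 4 * B / s * dist y y' := by
  intro y hy y' hy'
  rw [dist_eq_norm, dist_eq_norm]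
  refine (convex_ball x (s / 2)).norm_image_sub_le_of_norm_deriv_le (𝕜 := ℂ) (fun w hw => ?_)
    (fun w hw => ?_) hy' hy
  · exact hf.differentiableAt (isOpen_ball.mem_nhds (ball_subset_ball (by linarith) hw))
  · refine (norm_deriv_le_of_ball (half_pos hs) (hf.mono (ball_half_subset hw))
      fun v hv => hB v (ball_half_subset hw hv)).trans (le_of_eq ?_)
    field_simp; ring

/-- Montel's theorem. -/
theorem exists_subseq_tendstoLocallyUniformlyOn {U : Set ℂ} (F : ℕ → ℂ → ℂ)
    (hF : ∀ x ∈ U, ∃ s > 0, ball x s ⊆ U ∧ ∃ B : ℝ, ∀ᶠ n in atTop,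
      DifferentiableOn ℂ (F n) (ball x s) ∧ ∀ y ∈ ball x s, ‖F n y‖ ≤ B) :
    ∃ φ : ℕ → ℕ, StrictMono φ ∧ ∃ g : ℂ → ℂ,
      TendstoLocallyUniformlyOn (fun n => F (φ n)) g atTop U := by
  refine exists_subseq_tendstoLocallyUniformlyOn_of_lipschitz F fun x hx => ?_
  obtain ⟨s, hs, hsU, B, h⟩ := hF x hx
  have hsub := ball_subset_ball (x := x) (by linarith : s / 2 ≤ s)
  refine ⟨s / 2, half_pos hs, hsub.trans hsU, B, 4 * B / s, ?_⟩
  filter_upwards [h] with n hn y hy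
  exact ⟨hn.2 y (hsub hy), dist_le_of_norm_le_on_ball hs hn.1 hn.2 y hy⟩

/-- Minimum principle: a zero-free holomorphic function on a disk is bounded below by its
boundary values. -/
theorem le_norm_of_le_sphere {f : ℂ → ℂ} {x : ℂ} {r m : ℝ} (hr : 0 < r) (hm : 0 < m)
    (hf : ∀ z ∈ closedBall x r, DifferentiableAt ℂ f z) (h0 : ∀ z ∈ ball x r, f z ≠ 0)
    (hs : ∀ z ∈ sphere x r, m ≤ ‖f z‖) : m ≤ ‖f x‖ := by
  have hne : ∀ z ∈ closedBall x r, f z ≠ 0 := fun z hz => by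
    rcases (mem_closedBall.1 hz).lt_or_eq with h | h
    · exact h0 z h
    · exact norm_pos_iff.1 (hm.trans_le (hs z h))
  have hd : DiffContOnCl ℂ (fun z => (f z)⁻¹) (ball x r) := by
    refine DifferentiableOn.diffContOnCl ?_
    rw [closure_ball x hr.ne']
    exact fun z hz => ((hf z hz).inv (hne z hz)).differentiableWithinAt
  have := norm_le_of_forall_mem_frontier_norm_le isBounded_ball hd (C := m⁻¹) (fun z hz => by
    rw [frontier_ball x hr.ne'] at hz
    rw [norm_inv]
    exact inv_anti₀ hm (hs z hz)) (subset_closure (mem_ball_self hr))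
  rw [norm_inv] at this
  exact (inv_le_inv₀ (norm_pos_iff.2 (hne x (mem_closedBall_self hr.le))) hm).1 this

/-- Hurwitz's theorem. -/
theorem eventually_exists_zero_of_tendstoLocallyUniformlyOn {U : Set ℂ} (hU : IsOpen U)
    {F : ℕ → ℂ → ℂ} {f : ℂ → ℂ} (hF : ∀ᶠ n in atTop, DifferentiableOn ℂ (F n) U)
    (h : TendstoLocallyUniformlyOn F f atTop U) {p : ℂ} (hp : p ∈ U) (hfp : f p = 0)
    (hf0 : ¬ ∀ᶠ z in 𝓝 p, f z = 0) {δ : ℝ} (hδ : 0 < δ) :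
    ∀ᶠ n in atTop, ∃ z ∈ ball p δ, F n z = 0 := by
  have hfd : DifferentiableOn ℂ f U := h.differentiableOn hF hU
  have han : AnalyticAt ℂ f p := hfd.analyticAt (hU.mem_nhds hp)
  have hev := han.eventually_eq_zero_or_eventually_ne_zero.resolve_left hf0
  rw [eventually_nhdsWithin_iff] at hev
  obtain ⟨s, hs, hsball⟩ := Metric.eventually_nhds_iff.1 (hev.and (hU.mem_nhds hp))
  set r := min s δ / 2 with hr
  have hmin : 0 < min s δ := lt_min hs hδ
  have hr0 : 0 < r := half_pos hmin
  have hrs : r < s := by linarith [min_le_left s δ]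
  have hrδ : r < δ := by linarith [min_le_right s δ]
  have hcU : closedBall p r ⊆ U := fun z hz => (hsball ((mem_closedBall.1 hz).trans_lt hrs)).2
  obtain ⟨w, hw, hwmin⟩ := (isCompact_sphere p r).exists_isMinOn
    (NormedSpace.sphere_nonempty.2 hr0.le)
    ((hfd.continuousOn.mono (sphere_subset_closedBall.trans hcU)).norm)
  have hfw : 0 < ‖f w‖ := norm_pos_iff.2 <|
    (hsball (show dist w p < s by rw [mem_sphere.1 hw]; exact hrs)).1
      (ne_of_mem_sphere hw hr0.ne')
  have hunif := Metric.tendstoUniformlyOn_iff.1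
    ((tendstoLocallyUniformlyOn_iff_forall_isCompact hU).1 h _ hcU (isCompact_closedBall p r))
    (‖f w‖ / 3) (by positivity)
  filter_upwards [hunif, hF] with n hn hdn
  by_contra! hcon
  have hle := le_norm_of_le_sphere (f := F n) hr0 (m := 2 * ‖f w‖ / 3) (by positivity)
    (fun z hz => hdn.differentiableAt (hU.mem_nhds (hcU hz)))
    (fun z hz => hcon z (ball_subset_ball hrδ.le hz)) (fun z hz => by
      have h1 := hn z (sphere_subset_closedBall hz)
      have h2 : ‖f w‖ ≤ ‖f z‖ := hwmin hz
      rw [dist_eq_norm] at h1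
      linarith [norm_sub_norm_le (f z) (F n z)])
  have h1 := hn p (mem_closedBall_self hr0.le)
  rw [hfp, dist_zero_left] at h1
  linarith

theorem tendstoLocallyUniformlyOn_riccatiPoly {U : Set ℂ} (hU : IsOpen U) {H : ℕ → ℂ → ℂ}
    {h : ℂ → ℂ} (hd : ∀ᶠ n in atTop, DifferentiableOn ℂ (H n) U)
    (hH : TendstoLocallyUniformlyOn H h atTop U) (j : ℕ) :
    TendstoLocallyUniformlyOn (fun n => riccatiPoly (H n) j) (riccatiPoly h j) atTop U := by
  have hhd : DifferentiableOn ℂ h U := hH.differentiableOn hd hU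
  induction j with
  | zero =>
    refine Metric.tendstoLocallyUniformlyOn_iff.2 fun ε hε x _ => ⟨U, self_mem_nhdsWithin, ?_⟩
    exact Eventually.of_forall fun n y _ => by simpa [riccatiPoly] using hε
  | succ j ih =>
    have hPd : ∀ᶠ n in atTop, DifferentiableOn ℂ (riccatiPoly (H n) j) U :=
      hd.mono fun n hn => differentiableOn_riccatiPoly hU hn j
    exact (ih.deriv hPd hU).add (hH.mul₀ ih hhd.continuousOn
      (differentiableOn_riccatiPoly hU hhd j).continuousOn)

/-- Functions normalized by `1 ≤ ‖deriv (H n) 0‖` and of bounded spherical derivative on growing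
disks cannot have asymptotically zero-free Riccati polynomials. -/
theorem false_of_rescaled_sequence {k : ℕ} (hk : 2 ≤ k) {H β : ℕ → ℂ → ℂ} {C : ℝ} (hC0 : 0 ≤ C)
    (hd : ∀ R : ℝ, ∀ᶠ n in atTop, DifferentiableOn ℂ (H n) (ball 0 R))
    (hM : ∀ R : ℝ, ∀ᶠ n in atTop, ∀ z ∈ ball (0 : ℂ) R,
      ‖deriv (H n) z‖ ≤ 4 * (1 + ‖H n z‖ ^ 2))
    (hC : ∀ R : ℝ, ∀ᶠ n in atTop, ∀ z ∈ ball (0 : ℂ) R, ‖H n z‖ ≤ Real.exp (C * (1 + ‖z‖)))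
    (h1 : ∀ᶠ n in atTop, 1 ≤ ‖deriv (H n) 0‖)
    (hβd : ∀ R : ℝ, ∀ᶠ n in atTop, DifferentiableOn ℂ (β n) (ball 0 R))
    (hβ : ∀ R : ℝ, ∀ ε > 0, ∀ᶠ n in atTop, ∀ z ∈ ball (0 : ℂ) R, ‖β n z‖ < ε)
    (hz : ∀ R : ℝ, ∀ᶠ n in atTop, ∀ z ∈ ball (0 : ℂ) R, ∀ w ∈ ball (0 : ℂ) R,
      riccatiPoly (H n) k z + β n z = 0 → riccatiPoly (H n) k w + β n w = 0 → z = w) : False := by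
  obtain ⟨φ, hφ, g, hg⟩ := exists_subseq_tendstoLocallyUniformlyOn (U := univ) H fun x _ => by
    refine ⟨1, one_pos, subset_univ _, Real.exp (C * (2 + ‖x‖)), ?_⟩
    filter_upwards [hd (‖x‖ + 1), hC (‖x‖ + 1)] with n hn1 hn2
    have hsub : ball x 1 ⊆ ball 0 (‖x‖ + 1) := ball_subset_ball' (by simp [add_comm])
    refine ⟨hn1.mono hsub, fun y hy => (hn2 y (hsub hy)).trans (Real.exp_le_exp.2 ?_)⟩
    have := mem_ball_zero_iff.1 (hsub hy)
    exact mul_le_mul_of_nonneg_left (by linarith) hC0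
  have hφt := hφ.tendsto_atTop
  have hgR : ∀ R : ℝ, TendstoLocallyUniformlyOn (fun n => H (φ n)) g atTop (ball 0 R) :=
    fun R => hg.mono (subset_univ _)
  have hdφ := fun R => hφt.eventually (hd R)
  have hgd : Differentiable ℂ g := fun z =>
    ((hgR (‖z‖ + 1)).differentiableOn (hdφ _) isOpen_ball).differentiableAt
      (isOpen_ball.mem_nhds (by simp))
  have hmem : ∀ z : ℂ, z ∈ ball (0 : ℂ) (‖z‖ + 1) := fun z => by simp
  have hpt : ∀ z, Tendsto (fun n => H (φ n) z) atTop (𝓝 (g z)) := fun z =>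
    (hgR _).tendsto_at (hmem z)
  have hptd : ∀ z, Tendsto (fun n => deriv (H (φ n)) z) atTop (𝓝 (deriv g z)) := fun z =>
    ((hgR _).deriv (hdφ _) isOpen_ball).tendsto_at (hmem z)
  have hgM : ∀ z, ‖deriv g z‖ ≤ 4 * (1 + ‖g z‖ ^ 2) := fun z =>
    le_of_tendsto_of_tendsto (hptd z).norm ((((hpt z).norm.pow 2).const_add 1).const_mul 4)
      ((hφt.eventually (hM (‖z‖ + 1))).mono fun n hn => hn z (hmem z))
  have hgC : ∀ z, ‖g z‖ ≤ Real.exp (C * (1 + ‖z‖)) := fun z =>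
    le_of_tendsto (hpt z).norm
      ((hφt.eventually (hC (‖z‖ + 1))).mono fun n hn => hn z (hmem z))
  have hg1 : 1 ≤ ‖deriv g 0‖ := ge_of_tendsto (hptd 0).norm (hφt.eventually h1)
  have hPd := differentiable_riccatiPoly hgd k
  have hconst := deriv_eq_zero_of_riccatiPoly hgd hgM hC0 hgC hk (by
    by_contra! hcon
    obtain ⟨⟨x, hx⟩, z, w, hz0, hw0, hne⟩ := hcon
    have hnz : ∀ p, ¬ ∀ᶠ y in 𝓝 p, riccatiPoly g k y = 0 := fun p hev => by
      have := (AnalyticOnNhd.eqOn_zero_of_preconnected_of_eventuallyEq_zero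
        (fun y _ => hPd.analyticAt y) isPreconnected_univ (mem_univ p) hev) (mem_univ x)
      exact hx this
    have hdist : 0 < dist z w := dist_pos.2 hne
    set R := ‖z‖ + ‖w‖ + dist z w with hR
    have hlim : TendstoLocallyUniformlyOn
        ((fun n => riccatiPoly (H (φ n)) k) + fun n => β (φ n)) (riccatiPoly g k + 0)
        atTop (ball 0 R) := by
      refine (tendstoLocallyUniformlyOn_riccatiPoly isOpen_ball (hdφ R) (hgR R) k).add ?_
      refine Metric.tendstoLocallyUniformlyOn_iff.2 fun ε hε x _ =>
        ⟨ball 0 R, self_mem_nhdsWithin, ?_⟩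
      filter_upwards [hφt.eventually (hβ R ε hε)] with n hn y hy
      simpa using hn y hy
    rw [add_zero] at hlim
    have hdd : ∀ᶠ n in atTop, DifferentiableOn ℂ
        (((fun n => riccatiPoly (H (φ n)) k) + fun n => β (φ n)) n) (ball 0 R) := by
      filter_upwards [hdφ R, hφt.eventually (hβd R)] with n hn1 hn2
      exact (differentiableOn_riccatiPoly isOpen_ball hn1 k).add hn2
    have hzR : ‖z‖ + dist z w / 2 ≤ R := by linarith [norm_nonneg w]
    have hwR : ‖w‖ + dist z w / 2 ≤ R := by linarith [norm_nonneg z]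
    have hev := ((eventually_exists_zero_of_tendstoLocallyUniformlyOn isOpen_ball hdd hlim
        (mem_ball_zero_iff.2 (by linarith)) hz0 (hnz z) (half_pos hdist)).and
      (eventually_exists_zero_of_tendstoLocallyUniformlyOn isOpen_ball hdd hlim
        (mem_ball_zero_iff.2 (by linarith)) hw0 (hnz w) (half_pos hdist))).and
      (hφt.eventually (hz R))
    obtain ⟨n, ⟨⟨z', hz', hz'0⟩, w', hw', hw'0⟩, hn⟩ := hev.exists
    have hsub : ∀ p : ℂ, ‖p‖ + dist z w / 2 ≤ R → ball p (dist z w / 2) ⊆ ball 0 R :=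
      fun p hp => ball_subset_ball' (by rw [dist_zero_right]; linarith)
    have := hn z' (hsub z hzR hz') w' (hsub w hwR hw') hz'0 hw'0
    subst this
    rw [mem_ball] at hz' hw'
    linarith [dist_triangle_left z w z']) 0
  rw [hconst, norm_zero] at hg1
  linarith

theorem hasDerivAt_rescale {h : ℂ → ℂ} {a ρ z : ℂ} (hd : DifferentiableAt ℂ h (a + ρ * z)) :
    HasDerivAt (fun w => ρ * h (a + ρ * w)) (ρ ^ 2 * deriv h (a + ρ * z)) z := by
  have h1 : HasDerivAt (fun x : ℂ => a + ρ * x) ρ z := by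
    simpa using ((hasDerivAt_id z).const_mul ρ).const_add a
  refine ((hd.hasDerivAt.comp z h1).const_mul ρ).congr_deriv ?_
  ring

/-- Zalcman-type rescaling at points of large spherical derivative. -/
theorem exists_rescale {h : ℂ → ℂ} {z₀ x : ℂ} {r s N : ℝ} (hs : 0 < s) (hsr : s < r) (hN : 1 ≤ N)
    (hd : DifferentiableOn ℂ h (ball z₀ r)) (hx : x ∈ ball z₀ (s / 2))
    (hxN : N * (1 + ‖h x‖ ^ 2) < ‖deriv h x‖) :
    ∃ (a : ℂ) (ρ : ℝ), 0 < ρ ∧ ρ ^ 2 ≤ 4 / N ∧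
      (∀ ζ ∈ ball (0 : ℂ) (s * √N / 4), a + ρ * ζ ∈ ball z₀ s ∧
        ‖deriv (fun w => ρ * h (a + ρ * w)) ζ‖ ≤ 4 * (1 + ‖ρ * h (a + ρ * ζ)‖ ^ 2)) ∧
      1 + ‖ρ * h (a + ρ * 0)‖ ^ 2 ≤ ‖deriv (fun w => ρ * h (a + ρ * w)) 0‖ := by
  set μ : ℂ → ℝ := fun z => ‖deriv h z‖ - ‖h z‖ ^ 2 with hμ
  set Φ : ℂ → ℝ := fun z => (s - dist z z₀) ^ 2 * μ z with hΦ
  have hsub : closedBall z₀ s ⊆ ball z₀ r := closedBall_subset_ball hsr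
  have hΦc : ContinuousOn Φ (closedBall z₀ s) := by
    have h1 := (hd.continuousOn.mono hsub).norm
    have h2 := ((hd.deriv isOpen_ball).continuousOn.mono hsub).norm
    exact ContinuousOn.mul (by fun_prop) (h2.sub (h1.pow 2))
  obtain ⟨a, ha, hmax⟩ := (isCompact_closedBall z₀ s).exists_isMaxOn
    ⟨z₀, mem_closedBall_self hs.le⟩ hΦc
  have hN0 : 0 < N := by linarith
  have hμx : N ≤ μ x := by
    simp only [hμ]
    nlinarith [sq_nonneg ‖h x‖]
  have hxd : s / 2 ≤ s - dist x z₀ := by linarith [mem_ball.1 hx]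
  have hΦx : s ^ 2 * N / 4 ≤ Φ x := by
    calc s ^ 2 * N / 4 = (s / 2) ^ 2 * N := by ring
      _ ≤ _ := by simp only [hΦ]; gcongr
  have hΦa : s ^ 2 * N / 4 ≤ Φ a :=
    hΦx.trans (hmax (ball_subset_closedBall (ball_subset_ball (by linarith) hx)))
  have hΦpos : 0 < Φ a := lt_of_lt_of_le (by positivity) hΦa
  set δ := s - dist a z₀ with hδ
  have hδ0 : 0 ≤ δ := by linarith [mem_closedBall.1 ha]
  have hδs : δ ≤ s := by linarith [dist_nonneg (x := a) (y := z₀)]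
  have hδpos : 0 < δ := hδ0.lt_of_ne' fun h0 => by
    simp [hΦ, ← hδ, h0] at hΦpos
  have hΦe : Φ a = δ ^ 2 * μ a := rfl
  have hμa : 0 < μ a := by
    rw [hΦe] at hΦpos
    exact pos_of_mul_pos_right hΦpos (by positivity)
  have hμN : N / 4 ≤ μ a := by
    have h1 : s ^ 2 * N / 4 ≤ s ^ 2 * μ a := hΦa.trans (by rw [hΦe]; gcongr)
    have h2 : s ^ 2 * (N / 4) ≤ s ^ 2 * μ a := by linarith
    exact le_of_mul_le_mul_left h2 (by positivity)
  set ρ : ℝ := (√(μ a))⁻¹ with hρ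
  have hρ0 : 0 < ρ := by positivity
  have hρ2 : ρ ^ 2 * μ a = 1 := by
    rw [hρ, inv_pow, Real.sq_sqrt hμa.le]; field_simp
  have hρR : ρ * (s * √N / 4) ≤ δ / 2 := by
    have h1 : (s * √N / 2) ^ 2 ≤ (δ * √(μ a)) ^ 2 := by
      rw [div_pow, mul_pow, mul_pow, Real.sq_sqrt hN0.le, Real.sq_sqrt hμa.le]
      linarith
    have h2 := le_of_sq_le_sq h1 (by positivity)
    rw [hρ, inv_mul_le_iff₀ (by positivity)]
    linarith
  have hnρ : ‖(ρ : ℂ)‖ = ρ := by rw [norm_real, Real.norm_of_nonneg hρ0.le]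
  have hmem : ∀ ζ ∈ ball (0 : ℂ) (s * √N / 4), dist (a + ρ * ζ) z₀ ≤ s - δ / 2 := fun ζ hζ => by
    have h1 : dist (a + ρ * ζ) a ≤ δ / 2 := by
      rw [dist_eq_norm, add_sub_cancel_left, norm_mul, hnρ]
      exact (mul_le_mul_of_nonneg_left (mem_ball_zero_iff.1 hζ).le hρ0.le).trans hρR
    linarith [dist_triangle (a + ρ * ζ) a z₀]
  refine ⟨a, ρ, hρ0, ?_, fun ζ hζ => ⟨?_, ?_⟩, ?_⟩
  · rw [le_div_iff₀ hN0]
    nlinarith [mul_le_mul_of_nonneg_left hμN (sq_nonneg ρ)]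
  · exact (hmem ζ hζ).trans_lt (by linarith)
  · set z := a + ρ * ζ with hz
    have hzc : z ∈ closedBall z₀ s := (hmem ζ hζ).trans (by linarith)
    rw [(hasDerivAt_rescale (hd.differentiableAt (isOpen_ball.mem_nhds (hsub hzc)))).deriv,
      norm_mul, norm_mul, norm_pow, hnρ, ← hz]
    have hΦz : (s - dist z z₀) ^ 2 * μ z ≤ δ ^ 2 * μ a := hmax hzc
    have hμz : μ z ≤ 4 * μ a := by
      by_cases h0 : μ z ≤ 0
      · linarith
      · push Not at h0
        have h1 : (δ / 2) ^ 2 * μ z ≤ (s - dist z z₀) ^ 2 * μ z := by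
          gcongr
          linarith [hmem ζ hζ]
        have h2 : δ ^ 2 * μ z ≤ δ ^ 2 * (4 * μ a) := by linarith
        exact le_of_mul_le_mul_left h2 (by positivity)
    have h3 : ‖deriv h z‖ ≤ 4 * μ a + ‖h z‖ ^ 2 := by simp only [hμ] at hμz ⊢; linarith
    calc ρ ^ 2 * ‖deriv h z‖ ≤ ρ ^ 2 * (4 * μ a + ‖h z‖ ^ 2) := by gcongr
      _ = 4 + (ρ * ‖h z‖) ^ 2 := by linear_combination 4 * hρ2
      _ ≤ _ := by nlinarith [sq_nonneg (ρ * ‖h z‖)]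
  · rw [(hasDerivAt_rescale (by
      rw [mul_zero, add_zero]
      exact hd.differentiableAt (isOpen_ball.mem_nhds (hsub ha)))).deriv,
      norm_mul, norm_mul, norm_pow, hnρ, mul_zero, add_zero]
    refine le_of_eq ?_
    simp only [hμ] at hρ2
    linear_combination (-1 : ℝ) * hρ2

theorem exists_norm_le_one_of_le_norm_deriv {H : ℂ → ℂ} (hd : DifferentiableOn ℂ H (ball 0 3))
    (h1 : 1 + ‖H 0‖ ^ 2 ≤ ‖deriv H 0‖) : ∃ y ∈ ball (0 : ℂ) 3, ‖H y‖ ≤ 1 := by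
  by_contra! hcon
  have h3 : (0 : ℝ) < 3 := by norm_num
  have h0 : (0 : ℂ) ∈ ball (0 : ℂ) 3 := mem_ball_self h3
  obtain ⟨G, hG, hGe⟩ := exists_log_on_ball h3 hd fun w hw => norm_pos_iff.1
    (one_pos.trans (hcon w hw))
  have hre : ∀ w ∈ ball (0 : ℂ) 3, Real.exp (G w).re = ‖H w‖ := fun w hw => by
    rw [hGe w hw, norm_exp]
  have := (halfPlane_schwarz h3 (F := G) (z := 0)
    (fun w hw => (hG w hw).differentiableAt.differentiableWithinAt)
    (fun w hw => by
      have h2 := hcon w hw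
      rwa [← hre w hw, Real.one_lt_exp_iff] at h2)).1
  rw [(hG 0 h0).deriv, norm_div] at this
  have hpos : 0 < ‖H 0‖ := one_pos.trans (hcon 0 h0)
  have h4 := Real.add_one_le_exp (G 0).re
  rw [hre 0 h0] at h4
  rw [div_le_iff₀ hpos] at this
  have h5 := hcon 0 h0
  have h6 : 2 * (G 0).re / 3 * ‖H 0‖ ≤ ‖H 0‖ * ‖H 0‖ := by gcongr; linarith
  nlinarith

/-- Marty's criterion near a point where the omitted function is holomorphic, up to one
exceptional point. -/
theorem exists_norm_deriv_le_of_riccatiPoly_ne {k : ℕ} (hk : 2 ≤ k) {b : ℂ → ℂ} {z₀ : ℂ} {r : ℝ}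
    (hr : 0 < r) (hb : DifferentiableOn ℂ b (ball z₀ r)) :
    ∃ M : ℝ, ∃ s > 0, ∀ h : ℂ → ℂ, DifferentiableOn ℂ h (ball z₀ r) →
      (∀ z ∈ ball z₀ r, z ≠ z₀ → riccatiPoly h k z + b z ≠ 0) →
      ∀ z ∈ ball z₀ s, ‖deriv h z‖ ≤ M * (1 + ‖h z‖ ^ 2) := by
  by_contra! hcon
  set s := r / 2 with hs
  have hs0 : 0 < s := half_pos hr
  have hsr : s < r := half_lt_self hr
  choose h hd hne x hx hxN using fun n : ℕ => hcon (n + 1 : ℝ) (s / 2) (half_pos hs0)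
  choose a ρ hρ0 hρN hH h0 using fun n : ℕ =>
    exists_rescale hs0 hsr (by linarith [n.cast_nonneg (α := ℝ)]) (hd n) (hx n) (hxN n)
  obtain ⟨B, hB⟩ := (isCompact_closedBall z₀ s).exists_bound_of_continuousOn
    (hb.continuousOn.mono (closedBall_subset_ball hsr))
  have hB0 : 0 ≤ B := (norm_nonneg _).trans (hB z₀ (mem_closedBall_self hs0.le))
  have hsub : ball z₀ s ⊆ ball z₀ r := ball_subset_ball hsr.le
  have hRinf : Tendsto (fun n : ℕ => s * √((n : ℝ) + 1) / 4) atTop atTop :=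
    ((Real.tendsto_sqrt_atTop.comp (tendsto_atTop_add_const_right _ _
      tendsto_natCast_atTop_atTop)).const_mul_atTop hs0).atTop_div_const (by norm_num)
  have hdiff : ∀ (n : ℕ) (f : ℂ → ℂ), DifferentiableOn ℂ f (ball z₀ r) →
      DifferentiableOn ℂ (fun w => f (a n + ρ n * w)) (ball 0 (s * √((n : ℝ) + 1) / 4)) :=
    fun n f hf w hw => DifferentiableAt.differentiableWithinAt <|
      DifferentiableAt.fun_comp' (f := fun w : ℂ => a n + ρ n * w) w
        (hf.differentiableAt (isOpen_ball.mem_nhds (hsub (hH n w hw).1))) (by fun_prop)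
  have hρt : Tendsto (fun n : ℕ => 4 / ((n : ℝ) + 1)) atTop (𝓝 0) :=
    (tendsto_atTop_add_const_right _ _ tendsto_natCast_atTop_atTop).const_div_atTop 4
  refine false_of_rescaled_sequence hk (H := fun n w => ρ n * h n (a n + ρ n * w))
    (β := fun n w => (ρ n : ℂ) ^ k * b (a n + ρ n * w)) (C := 48) (by norm_num)
    (fun R => ?_) (fun R => ?_) (fun R => ?_) (Eventually.of_forall fun n => ?_) (fun R => ?_)
    (fun R ε hε => ?_) (fun R => ?_)
  · filter_upwards [hRinf.eventually_ge_atTop R] with n hn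
    exact ((hdiff n _ (hd n)).const_mul _).mono (ball_subset_ball hn)
  · filter_upwards [hRinf.eventually_ge_atTop R] with n hn z hz
    exact (hH n z (ball_subset_ball hn hz)).2
  · filter_upwards [hRinf.eventually_ge_atTop (2 * R + 4), hRinf.eventually_ge_atTop 3]
      with n hn hn3 z hz
    have hdn : DifferentiableOn ℂ (fun w => ρ n * h n (a n + ρ n * w))
      (ball 0 (s * √((n : ℝ) + 1) / 4)) := (hdiff n _ (hd n)).const_mul _
    obtain ⟨y, hy, hy1⟩ := exists_norm_le_one_of_le_norm_deriv
      (hdn.mono (ball_subset_ball hn3)) (h0 n)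
    have hzR := mem_ball_zero_iff.1 hz
    have hsubz : ball z (‖z‖ + 4) ⊆ ball 0 (s * √((n : ℝ) + 1) / 4) :=
      ball_subset_ball' (by rw [dist_zero_right]; linarith)
    have hyz : dist y z ≤ ‖z‖ + 3 := by
      rw [mem_ball_zero_iff] at hy
      rw [dist_eq_norm]
      linarith [norm_sub_le y z]
    have := norm_le_exp_of_norm_deriv_le le_rfl (hdn.mono hsubz)
      (fun w hw => (hH n w (hsubz hw)).2) (mem_ball.2 (by linarith : dist y z < ‖z‖ + 4)) hy1
    refine this.trans ?_
    rw [one_mul]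
    refine Real.exp_le_exp.2 ?_
    linarith [norm_nonneg z]
  · exact le_trans (by linarith [sq_nonneg ‖(ρ n : ℂ) * h n (a n + ρ n * 0)‖]) (h0 n)
  · filter_upwards [hRinf.eventually_ge_atTop R] with n hn
    exact ((hdiff n _ hb).const_mul _).mono (ball_subset_ball hn)
  · have hlim : Tendsto (fun n : ℕ => 4 / ((n : ℝ) + 1) * B) atTop (𝓝 0) := by
      simpa using hρt.mul_const B
    filter_upwards [hRinf.eventually_ge_atTop R, hlim.eventually_lt_const hε,
      hρt.eventually_le_const one_pos] with n hn hn1 hn2 z hz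
    refine lt_of_le_of_lt ?_ hn1
    rw [norm_mul, norm_pow, norm_real, Real.norm_of_nonneg (hρ0 n).le]
    have hρ1 : ρ n ≤ 1 := by nlinarith [hρN n, hρ0 n]
    have h2 : ρ n ^ k ≤ 4 / ((n : ℝ) + 1) :=
      (pow_le_pow_of_le_one (hρ0 n).le hρ1 hk).trans (hρN n)
    gcongr
    exact hB _ (ball_subset_closedBall (hH n z (ball_subset_ball hn hz)).1)
  · filter_upwards [hRinf.eventually_ge_atTop R] with n hn z hz w hw hz0 hw0
    have hρC : (ρ n : ℂ) ≠ 0 := ofReal_ne_zero.2 (hρ0 n).ne'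
    have key : ∀ z ∈ ball (0 : ℂ) R, riccatiPoly (fun w => ρ n * h n (a n + ρ n * w)) k z +
        (ρ n : ℂ) ^ k * b (a n + ρ n * z) = 0 → a n + ρ n * z = z₀ := fun z hz h => by
      by_contra hcon
      rw [riccatiPoly_scale, ← mul_add] at h
      exact hne n _ (hsub (hH n z (ball_subset_ball hn hz)).1) hcon
        ((mul_eq_zero.1 h).resolve_left (pow_ne_zero _ hρC))
    have := (key z hz hz0).trans (key w hw hw0).symm
    exact mul_left_cancel₀ hρC (add_left_cancel this)

/-- Local bounds on spherical derivatives that hold for a whole family of functions are uniform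
near a compact set. -/
theorem exists_uniform_norm_deriv_le {𝓗 : Set (ℂ → ℂ)} {S : Set ℂ} (hS : IsCompact S)
    (h : ∀ x ∈ S, ∃ M : ℝ, ∃ s > 0, ∀ h ∈ 𝓗, ∀ w ∈ ball x s,
      ‖deriv h w‖ ≤ M * (1 + ‖h w‖ ^ 2)) :
    ∃ M : ℝ, ∃ η > 0, ∀ h ∈ 𝓗, ∀ x ∈ S, ∀ w ∈ ball x η, ‖deriv h w‖ ≤ M * (1 + ‖h w‖ ^ 2) := by
  refine hS.induction_on (p := fun K => ∃ M : ℝ, ∃ η > 0, ∀ h ∈ 𝓗, ∀ x ∈ K, ∀ w ∈ ball x η,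
    ‖deriv h w‖ ≤ M * (1 + ‖h w‖ ^ 2)) ⟨0, 1, one_pos, by simp⟩ ?_ ?_ ?_
  · rintro K L hKL ⟨M, η, hη, hM⟩
    exact ⟨M, η, hη, fun h hh x hx => hM h hh x (hKL hx)⟩
  · rintro K L ⟨M, η, hη, hM⟩ ⟨M', η', hη', hM'⟩
    refine ⟨max M M', min η η', lt_min hη hη', ?_⟩
    rintro h hh x (hx | hx) w hw
    · refine (hM h hh x hx w (ball_subset_ball (min_le_left _ _) hw)).trans ?_
      gcongr
      exact le_max_left _ _
    · refine (hM' h hh x hx w (ball_subset_ball (min_le_right _ _) hw)).trans ?_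
      gcongr
      exact le_max_right _ _
  · intro x hx
    obtain ⟨M, s, hs, hM⟩ := h x hx
    refine ⟨ball x (s / 2), mem_nhdsWithin_of_mem_nhds (ball_mem_nhds _ (half_pos hs)), M, s / 2,
      half_pos hs, fun h hh y hy w hw => hM h hh w (ball_half_subset hy hw)⟩

/-- A bound at one point of a compact connected set propagates to the whole set, uniformly for a
family with bounded spherical derivatives near the set. -/
theorem exists_forall_norm_le_of_norm_le {𝓗 : Set (ℂ → ℂ)} {S : Set ℂ} (hS : IsCompact S)
    (hS' : IsPreconnected S) {M η : ℝ} (hη : 0 < η)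
    (hd : ∀ h ∈ 𝓗, ∀ x ∈ S, DifferentiableOn ℂ h (ball x η))
    (hM : ∀ h ∈ 𝓗, ∀ x ∈ S, ∀ w ∈ ball x η, ‖deriv h w‖ ≤ M * (1 + ‖h w‖ ^ 2)) (A : ℝ) :
    ∃ A' : ℝ, ∀ h ∈ 𝓗, ∀ x ∈ S, ∀ y ∈ S, ‖h x‖ ≤ A → ‖h y‖ ≤ A' := by
  let P : ℂ → ℂ → Prop := fun x y => ∀ A : ℝ, ∃ A' : ℝ, ∀ h ∈ 𝓗, ‖h x‖ ≤ A → ‖h y‖ ≤ A'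
  have hloc : ∀ A : ℝ, ∃ A' : ℝ, ∀ h ∈ 𝓗, ∀ x ∈ S, ∀ y ∈ S, dist x y < η →
      ‖h x‖ ≤ A → ‖h y‖ ≤ A' := by
    intro A
    refine ⟨max 1 A * Real.exp (4 * (|M| * max 1 A) * η), fun h hh x _ y hy hxy hx => ?_⟩
    refine (norm_le_exp_of_norm_deriv_le (M := |M|) (le_max_left 1 A) (hd h hh y hy)
      (fun w hw => (hM h hh y hy w hw).trans ?_) (mem_ball.2 hxy)
      (hx.trans (le_max_right _ _))).trans ?_
    · gcongr
      exact le_abs_self M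
    · have : (1 : ℝ) ≤ max 1 A := le_max_left _ _
      gcongr
  have hP : ∀ x ∈ S, ∀ y ∈ S, P x y := by
    intro x hx y hy
    refine hS'.induction₂' P (fun x hx => ?_) (fun x y z _ _ _ hxy hyz A => ?_) hx hy
    · filter_upwards [self_mem_nhdsWithin, mem_nhdsWithin_of_mem_nhds (ball_mem_nhds x hη)]
        with y hy hxy
      refine ⟨fun A => ?_, fun A => ?_⟩
      · obtain ⟨A', hA'⟩ := hloc A
        exact ⟨A', fun h hh => hA' h hh x hx y hy (mem_ball'.1 hxy)⟩
      · obtain ⟨A', hA'⟩ := hloc A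
        exact ⟨A', fun h hh => hA' h hh y hy x hx (mem_ball.1 hxy)⟩
    · obtain ⟨A₁, h₁⟩ := hxy A
      obtain ⟨A₂, h₂⟩ := hyz A₁
      exact ⟨A₂, fun h hh hx => h₂ h hh (h₁ h hh hx)⟩
  suffices ∃ A' : ℝ, ∀ h ∈ 𝓗, ∀ q ∈ S ×ˢ S, q ∈ S ×ˢ S → ‖h q.1‖ ≤ A → ‖h q.2‖ ≤ A' by
    obtain ⟨A', hA'⟩ := this
    exact ⟨A', fun h hh x hx y hy => hA' h hh (x, y) ⟨hx, hy⟩ ⟨hx, hy⟩⟩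
  refine (hS.prod hS).induction_on (p := fun K => ∃ A' : ℝ, ∀ h ∈ 𝓗, ∀ q ∈ K, q ∈ S ×ˢ S →
    ‖h q.1‖ ≤ A → ‖h q.2‖ ≤ A') ⟨0, by simp⟩ ?_ ?_ ?_
  · rintro K L hKL ⟨B, hB⟩
    exact ⟨B, fun h hh q hq => hB h hh q (hKL hq)⟩
  · rintro K L ⟨B, hB⟩ ⟨B', hB'⟩
    refine ⟨max B B', ?_⟩
    rintro h hh q (hq | hq) hqS hqA
    · exact (hB h hh q hq hqS hqA).trans (le_max_left _ _)
    · exact (hB' h hh q hq hqS hqA).trans (le_max_right _ _)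
  · rintro ⟨x, y⟩ ⟨hx, hy⟩
    obtain ⟨A₁, h₁⟩ := hloc A
    obtain ⟨A₂, h₂⟩ := hP x hx y hy A₁
    obtain ⟨A₃, h₃⟩ := hloc A₂
    refine ⟨ball x η ×ˢ ball y η, mem_nhdsWithin_of_mem_nhds
      (prod_mem_nhds (ball_mem_nhds x hη) (ball_mem_nhds y hη)), A₃, ?_⟩
    rintro h hh ⟨x', y'⟩ ⟨hx', hy'⟩ ⟨hx'S, hy'S⟩ hA
    exact h₃ h hh y hy y' hy'S (mem_ball'.1 hy')
      (h₂ h hh (h₁ h hh x' hx'S x hx (mem_ball.1 hx') hA))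

/-- Bounded spherical derivative near a pole of the omitted function. -/
theorem exists_norm_deriv_le_of_riccatiPoly_ne_pole {k : ℕ} (hk : 2 ≤ k) {g : ℂ → ℂ} {z₀ : ℂ}
    {r : ℝ} (hr : 0 < r) (hg : DifferentiableOn ℂ g (ball z₀ r)) (hg0 : g z₀ ≠ 0) {m : ℕ}
    (hm : m ≠ 0) :
    ∃ M : ℝ, ∃ s > 0, ∀ h : ℂ → ℂ, DifferentiableOn ℂ h (ball z₀ r) →
      (∀ z ∈ ball z₀ r, z ≠ z₀ → riccatiPoly h k z + g z / (z - z₀) ^ m ≠ 0) →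
      ∀ z ∈ ball z₀ s, ‖deriv h z‖ ≤ M * (1 + ‖h z‖ ^ 2) := by
  set δ := r / 2 with hδ
  have hδ0 : 0 < δ := half_pos hr
  let 𝓗 : Set (ℂ → ℂ) := {h | DifferentiableOn ℂ h (ball z₀ r) ∧
    ∀ z ∈ ball z₀ r, z ≠ z₀ → riccatiPoly h k z + g z / (z - z₀) ^ m ≠ 0}
  have hsub : ∀ x ∈ sphere z₀ δ, ball x δ ⊆ ball z₀ r := fun x hx =>
    ball_subset_ball' (by rw [mem_sphere.1 hx]; linarith)
  have hsub0 : ∀ x ∈ sphere z₀ δ, ∀ w ∈ ball x δ, w ≠ z₀ := by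
    rintro x hx w hw rfl
    exact (mem_ball'.1 hw).ne (mem_sphere.1 hx)
  obtain ⟨M, η', hη', hM'⟩ := exists_uniform_norm_deriv_le (𝓗 := 𝓗) (isCompact_sphere z₀ δ)
    fun x hx => by
      have hb : DifferentiableOn ℂ (fun z => g z / (z - z₀) ^ m) (ball x δ) :=
        (hg.mono (hsub x hx)).div (by fun_prop)
          fun w hw => pow_ne_zero _ (sub_ne_zero.2 (hsub0 x hx w hw))
      obtain ⟨M, s, hs, hM⟩ := exists_norm_deriv_le_of_riccatiPoly_ne hk hδ0 hb
      exact ⟨M, s, hs, fun h hh => hM h (hh.1.mono (hsub x hx))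
        fun z hz _ => hh.2 z (hsub x hx hz) (hsub0 x hx z hz)⟩
  obtain ⟨η, hη, hηη', hηδ⟩ : ∃ η > 0, η ≤ η' ∧ η ≤ δ :=
    ⟨min η' δ, lt_min hη' hδ0, min_le_left _ _, min_le_right _ _⟩
  have hM : ∀ h ∈ 𝓗, ∀ x ∈ sphere z₀ δ, ∀ w ∈ ball x η, ‖deriv h w‖ ≤ |M| * (1 + ‖h w‖ ^ 2) :=
    fun h hh x hx w hw => (hM' h hh x hx w (ball_subset_ball hηη' hw)).trans
      (mul_le_mul_of_nonneg_right (le_abs_self M) (by positivity))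
  have hdη : ∀ h ∈ 𝓗, ∀ x ∈ sphere z₀ δ, DifferentiableOn ℂ h (ball x η) :=
    fun h hh x hx => hh.1.mono ((ball_subset_ball hηδ).trans (hsub x hx))
  have hcl : closedBall z₀ δ ⊆ ball z₀ r := closedBall_subset_ball (by linarith)
  obtain ⟨G, hG⟩ := (isCompact_sphere z₀ δ).exists_bound_of_continuousOn
    (hg.continuousOn.mono (sphere_subset_closedBall.trans hcl))
  obtain ⟨A₀, hA₀1, hA₀⟩ := exists_norm_pow_le_riccatiPoly k (half_pos hη)
  set A₁ := A₀ * Real.exp (4 * (|M| * A₀) * η)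
  set A₂ := 2 * (G + ‖g z₀‖ + 1) / δ ^ m
  set A := max 1 (max A₁ A₂)
  obtain ⟨A', hA'⟩ := exists_forall_norm_le_of_norm_le (𝓗 := 𝓗) (isCompact_sphere z₀ δ)
    (isPreconnected_sphere (by simp [Complex.rank_real_complex]) z₀ δ) hη hdη hM A
  refine ⟨2 * A' / (δ / 2), δ / 2, half_pos hδ0, fun h hd hne z hz => ?_⟩
  have hh : h ∈ 𝓗 := ⟨hd, hne⟩
  by_cases hbig : ∀ x ∈ sphere z₀ δ, A < ‖h x‖
  · exfalso
    have hF : DifferentiableOn ℂ (fun z => (z - z₀) ^ m * riccatiPoly h k z + g z) (ball z₀ r) :=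
      (DifferentiableOn.mul (by fun_prop) (differentiableOn_riccatiPoly isOpen_ball hd k)).add hg
    have := le_norm_of_le_sphere (f := fun z => (z - z₀) ^ m * riccatiPoly h k z + g z)
      (m := ‖g z₀‖ + 1) hδ0 (by positivity)
      (fun z hz => hF.differentiableAt (isOpen_ball.mem_nhds (hcl hz)))
      (fun z hz h0 => ?_) (fun z hz => ?_)
    · simp [hm] at this
      linarith
    · rcases eq_or_ne z z₀ with rfl | hz0
      · simp [hm, hg0] at h0
      · refine hne z (hcl (ball_subset_closedBall hz)) hz0 ?_
        have h1 := pow_ne_zero m (sub_ne_zero.2 hz0)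
        field_simp
        linear_combination h0
    · have hAz := hbig z hz
      have h1 : ∀ w ∈ ball z (η / 2), A₀ ≤ ‖h w‖ := by
        intro w hw
        by_contra! hlt
        have hwη : w ∈ ball z η := ball_subset_ball (by linarith) hw
        have h2 := norm_le_exp_of_norm_deriv_le hA₀1 (hdη h hh z hz) (hM h hh z hz) hwη hlt.le
        have h3 : A₀ * Real.exp (4 * (|M| * A₀) * dist w z) ≤ A₁ := by
          have := (mem_ball.1 hwη).le
          simp only [A₁]
          gcongr
        have : A₁ ≤ A := (le_max_left _ _).trans (le_max_right _ _)
        linarith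
      have h2 := hA₀ h z ((hdη h hh z hz).mono (ball_subset_ball (by linarith))) h1
      have hA1 : 1 ≤ A := le_max_left _ _
      have hA2 : A₂ ≤ A := (le_max_right _ _).trans (le_max_right _ _)
      have h3 : ‖h z‖ ≤ ‖h z‖ ^ k := le_self_pow₀ (by linarith) (by omega)
      have h4 : G + ‖g z₀‖ + 1 ≤ δ ^ m * ‖riccatiPoly h k z‖ := by
        have h5 : A₂ / 2 ≤ ‖riccatiPoly h k z‖ := by linarith
        have hδm : 0 < δ ^ m := pow_pos hδ0 m
        calc G + ‖g z₀‖ + 1 = δ ^ m * (A₂ / 2) := by simp only [A₂]; field_simp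
          _ ≤ _ := mul_le_mul_of_nonneg_left h5 hδm.le
      have h6 : ‖(z - z₀) ^ m * riccatiPoly h k z‖ = δ ^ m * ‖riccatiPoly h k z‖ := by
        rw [norm_mul, norm_pow, ← dist_eq_norm, mem_sphere.1 hz]
      have h7 := hG z hz
      have h8 := norm_sub_le ((z - z₀) ^ m * riccatiPoly h k z + g z) (g z)
      rw [add_sub_cancel_right, h6] at h8
      linarith
  · push Not at hbig
    obtain ⟨y, hy, hyA⟩ := hbig
    have hmax : ∀ w ∈ closedBall z₀ δ, ‖h w‖ ≤ A' := by
      intro w hw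
      rw [← closure_ball z₀ hδ0.ne'] at hw
      refine Complex.norm_le_of_forall_mem_frontier_norm_le isBounded_ball ?_ ?_ hw
      · refine (hd.mono ?_).diffContOnCl
        rwa [closure_ball z₀ hδ0.ne']
      · rw [frontier_ball z₀ hδ0.ne']
        exact fun x hx => hA' h hh y hy x hx hyA
    have hzs : ball z (δ / 2) ⊆ closedBall z₀ δ :=
      (ball_half_subset hz).trans ball_subset_closedBall
    have h1 := norm_deriv_le_of_ball (half_pos hδ0) (hd.mono (hzs.trans hcl))
      fun w hw => hmax w (hzs hw)
    refine h1.trans (le_mul_of_one_le_right ?_ (by nlinarith [norm_nonneg (h z)]))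
    exact (norm_nonneg _).trans h1

theorem sRec_eq_riccatiPoly {k : ℕ} (hk : k ≠ 0) (f : ℂ → ℂ) (m : ℕ) :
    SRec k f m = fun z => -k * riccatiPoly (fun w => -ldd f w / k) (m + 1) z := by
  have hk' : (k : ℂ) ≠ 0 := Nat.cast_ne_zero.2 hk
  induction m with
  | zero =>
    funext z
    simp only [SRec, riccatiPoly, deriv_const', mul_one, zero_add]
    field_simp
  | succ m ih =>
    funext z
    rw [SRec, ih, riccatiPoly.eq_2 _ (m + 1)]
    beta_reduce
    rw [deriv_const_mul_field]
    ring

theorem sk_eq_riccatiPoly {k : ℕ} (hk : k ≠ 0) (f : ℂ → ℂ) (z : ℂ) :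
    Sk k f z = -k * riccatiPoly (fun w => -ldd f w / k) k z := by
  obtain ⟨m, rfl⟩ := Nat.exists_eq_succ_of_ne_zero hk
  exact congrFun (sRec_eq_riccatiPoly hk f m) z

/-- Local form of a meromorphic function: removable singularity or pole. -/
theorem exists_local_form {b : ℂ → ℂ} {z₀ : ℂ} (hb : MeromorphicAt b z₀) {U : Set ℂ}
    (hU : U ∈ 𝓝 z₀) :
    ∃ r > 0, ball z₀ r ⊆ U ∧ (∀ z ∈ ball z₀ r, z ≠ z₀ → AnalyticAt ℂ b z) ∧
      ((∃ g : ℂ → ℂ, DifferentiableOn ℂ g (ball z₀ r) ∧ ∀ z ∈ ball z₀ r, z ≠ z₀ → b z = g z) ∨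
        ∃ (g : ℂ → ℂ) (m : ℕ), DifferentiableOn ℂ g (ball z₀ r) ∧ g z₀ ≠ 0 ∧ m ≠ 0 ∧
          ∀ z ∈ ball z₀ r, z ≠ z₀ → b z = g z / (z - z₀) ^ m) := by
  have key : ∀ (g c : ℂ → ℂ), AnalyticAt ℂ g z₀ → (∀ᶠ z in 𝓝[≠] z₀, b z = c z) →
      ∃ r > 0, ball z₀ r ⊆ U ∧ (∀ z ∈ ball z₀ r, z ≠ z₀ → AnalyticAt ℂ b z) ∧
        DifferentiableOn ℂ g (ball z₀ r) ∧ ∀ z ∈ ball z₀ r, z ≠ z₀ → b z = c z := by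
    intro g c hg hc
    have h1 := eventually_nhdsWithin_iff.1 hc
    have h2 := eventually_nhdsWithin_iff.1 hb.eventually_analyticAt
    obtain ⟨r, hr, H⟩ := Metric.eventually_nhds_iff_ball.1
      (((h1.and h2).and hg.eventually_analyticAt).and hU)
    exact ⟨r, hr, fun z hz => (H z hz).2, fun z hz => (H z hz).1.1.2,
      fun z hz => (H z hz).1.2.differentiableAt.differentiableWithinAt,
      fun z hz => (H z hz).1.1.1⟩
  rcases eq_or_ne (meromorphicOrderAt b z₀) ⊤ with htop | htop
  · obtain ⟨r, hr, h1, h2, h3, h4⟩ := key (fun _ => 0) _ analyticAt_const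
      (meromorphicOrderAt_eq_top_iff.1 htop)
    exact ⟨r, hr, h1, h2, Or.inl ⟨_, h3, h4⟩⟩
  · obtain ⟨n, hn⟩ := WithTop.ne_top_iff_exists.1 htop
    obtain ⟨g, hg, hg0, hbg⟩ := (meromorphicOrderAt_eq_int_iff hb).1 hn.symm
    rcases le_or_gt 0 n with h0 | h0
    · lift n to ℕ using h0
      obtain ⟨r, hr, h1, h2, h3, h4⟩ := key (fun z => (z - z₀) ^ n * g z) _
        (((analyticAt_id.sub analyticAt_const).pow n).mul hg) hbg
      exact ⟨r, hr, h1, h2, Or.inl ⟨_, h3, fun z hz hz0 => by simpa using h4 z hz hz0⟩⟩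
    · obtain ⟨m, rfl⟩ := Int.exists_eq_neg_ofNat h0.le
      obtain ⟨r, hr, h1, h2, h3, h4⟩ := key g _ hg hbg
      refine ⟨r, hr, h1, h2, Or.inr ⟨g, m, h3, hg0, by omega, fun z hz hz0 => ?_⟩⟩
      rw [h4 z hz hz0, zpow_neg, zpow_natCast, smul_eq_mul, div_eq_inv_mul]

/-- The family of logarithmic derivatives has locally bounded spherical derivatives. -/
theorem exists_norm_deriv_ldd_le {k : ℕ} (hk : 2 ≤ k) {b : ℂ → ℂ} {U : Set ℂ} {z₀ : ℂ}
    (hU : U ∈ 𝓝 z₀) (hb : MeromorphicAt b z₀) :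
    ∃ M : ℝ, ∃ s > 0, ∀ f : ℂ → ℂ, DifferentiableOn ℂ (ldd f) U →
      (∀ z ∈ U, AnalyticAt ℂ b z → Sk k f z ≠ b z) →
      ∀ z ∈ ball z₀ s, ‖deriv (ldd f) z‖ ≤ M * (1 + ‖ldd f z‖ ^ 2) := by
  have hk0 : k ≠ 0 := by omega
  have hkC : (k : ℂ) ≠ 0 := Nat.cast_ne_zero.2 hk0
  have hk1 : (1 : ℝ) ≤ k := by exact_mod_cast (by omega : 1 ≤ k)
  have key : ∀ f : ℂ → ℂ, (∀ z ∈ U, AnalyticAt ℂ b z → Sk k f z ≠ b z) →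
      ∀ z ∈ U, AnalyticAt ℂ b z → riccatiPoly (fun w => -ldd f w / k) k z + b z / k ≠ 0 := by
    intro f hf z hz hbz h
    refine hf z hz hbz ?_
    rw [sk_eq_riccatiPoly hk0]
    linear_combination (-k : ℂ) * h + b z * mul_inv_cancel₀ hkC
  obtain ⟨r, hr, hrU, hbr, hform⟩ := exists_local_form hb hU
  have main : ∃ M : ℝ, ∃ s > 0, ∀ h : ℂ → ℂ, DifferentiableOn ℂ h (ball z₀ r) →
      (∀ z ∈ ball z₀ r, z ≠ z₀ → riccatiPoly h k z + b z / k ≠ 0) →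
      ∀ z ∈ ball z₀ s, ‖deriv h z‖ ≤ M * (1 + ‖h z‖ ^ 2) := by
    rcases hform with ⟨g, hg, hbg⟩ | ⟨g, m, hg, hg0, hm, hbg⟩
    · obtain ⟨M, s, hs, hM⟩ := exists_norm_deriv_le_of_riccatiPoly_ne hk hr (hg.div_const (k : ℂ))
      exact ⟨M, s, hs, fun h hd hne => hM h hd fun z hz hz0 => by
        rw [← hbg z hz hz0]; exact hne z hz hz0⟩
    · obtain ⟨M, s, hs, hM⟩ := exists_norm_deriv_le_of_riccatiPoly_ne_pole hk hr
        (hg.div_const (k : ℂ)) (div_ne_zero hg0 hkC) hm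
      exact ⟨M, s, hs, fun h hd hne => hM h hd fun z hz hz0 => by
        rw [div_right_comm, ← hbg z hz hz0]; exact hne z hz hz0⟩
  obtain ⟨M, s, hs, hM⟩ := main
  refine ⟨k * |M|, min s r, lt_min hs hr, fun f hd hf z hz => ?_⟩
  have h1 := hM _ ((hd.mono hrU).neg.div_const (k : ℂ))
    (fun z hz hz0 => key f hf z (hrU hz) (hbr z hz hz0)) z (ball_subset_ball (min_le_left _ _) hz)
  have hde : deriv (fun w => -ldd f w / (k : ℂ)) z = -deriv (ldd f) z / k := by
    rw [deriv_div_const, deriv.fun_neg]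
  have h2 : ‖-ldd f z / (k : ℂ)‖ ≤ ‖ldd f z‖ := by
    rw [norm_div, norm_neg, Complex.norm_natCast]
    exact div_le_self (norm_nonneg _) hk1
  have h3 : ‖deriv (ldd f) z‖ / k ≤ M * (1 + ‖-ldd f z / (k : ℂ)‖ ^ 2) := by
    simpa [hde, norm_div] using h1
  rw [div_le_iff₀ (by linarith)] at h3
  calc ‖deriv (ldd f) z‖ ≤ M * (1 + ‖-ldd f z / (k : ℂ)‖ ^ 2) * k := h3
    _ ≤ |M| * (1 + ‖ldd f z‖ ^ 2) * k := by
      gcongr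
      exact le_abs_self M
    _ = _ := by ring

/-- Inverse stereographic projection onto the sphere `‖u‖ ^ 2 + t ^ 2 = t`. -/
def invStereo (w : ℂ) : ℂ × ℝ := ((1 + ‖w‖ ^ 2)⁻¹ • w, (1 + ‖w‖ ^ 2)⁻¹)

/-- Extension of `invStereo` to the Riemann sphere. -/
def sphereEmb (x : OnePoint ℂ) : ℂ × ℝ := Option.elim x 0 invStereo

theorem sphDist_sq (x y : OnePoint ℂ) : sphDist x y ^ 2 =
    ‖(sphereEmb x).1 - (sphereEmb y).1‖ ^ 2 + ((sphereEmb x).2 - (sphereEmb y).2) ^ 2 := by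
  have hp : ∀ w : ℂ, 0 < 1 + ‖w‖ ^ 2 := fun w => by positivity
  induction x using OnePoint.rec with
  | infty =>
    induction y using OnePoint.rec with
    | infty => simp [sphDist, sphereEmb, OnePoint.infty]
    | coe w =>
      change (1 / √(1 + ‖w‖ ^ 2)) ^ 2 =
        ‖(0 : ℂ) - (1 + ‖w‖ ^ 2)⁻¹ • w‖ ^ 2 + ((0 : ℝ) - (1 + ‖w‖ ^ 2)⁻¹) ^ 2
      rw [div_pow, Real.sq_sqrt (hp w).le, zero_sub, norm_neg, norm_smul, Real.norm_eq_abs,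
        abs_of_pos (inv_pos.2 (hp w))]
      have := (hp w).ne'
      field_simp
      ring
  | coe z =>
    induction y using OnePoint.rec with
    | infty =>
      change (1 / √(1 + ‖z‖ ^ 2)) ^ 2 =
        ‖(1 + ‖z‖ ^ 2)⁻¹ • z - (0 : ℂ)‖ ^ 2 + ((1 + ‖z‖ ^ 2)⁻¹ - (0 : ℝ)) ^ 2
      rw [div_pow, Real.sq_sqrt (hp z).le, sub_zero, sub_zero, norm_smul, Real.norm_eq_abs,
        abs_of_pos (inv_pos.2 (hp z))]
      have := (hp z).ne'
      field_simp
      ring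
    | coe w =>
      change (‖z - w‖ / (√(1 + ‖z‖ ^ 2) * √(1 + ‖w‖ ^ 2))) ^ 2 =
        ‖(1 + ‖z‖ ^ 2)⁻¹ • z - (1 + ‖w‖ ^ 2)⁻¹ • w‖ ^ 2 +
          ((1 + ‖z‖ ^ 2)⁻¹ - (1 + ‖w‖ ^ 2)⁻¹) ^ 2
      rw [div_pow, mul_pow, Real.sq_sqrt (hp z).le, Real.sq_sqrt (hp w).le, norm_sub_sq_real,
        norm_sub_sq_real, norm_smul, norm_smul, real_inner_smul_left, real_inner_smul_right,
        Real.norm_eq_abs, Real.norm_eq_abs, abs_of_pos (inv_pos.2 (hp z)),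
        abs_of_pos (inv_pos.2 (hp w))]
      have h1 := (hp z).ne'
      have h2 := (hp w).ne'
      field_simp
      ring

theorem sphDist_le (x y : OnePoint ℂ) :
    sphDist x y ≤ 2 * dist (sphereEmb x) (sphereEmb y) := by
  refine le_of_sq_le_sq ?_ (by positivity)
  have h1 : ‖(sphereEmb x).1 - (sphereEmb y).1‖ ≤ dist (sphereEmb x) (sphereEmb y) := by
    rw [dist_eq_norm]
    exact norm_fst_le (sphereEmb x - sphereEmb y)
  have h2 : |(sphereEmb x).2 - (sphereEmb y).2| ≤ dist (sphereEmb x) (sphereEmb y) := by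
    rw [dist_eq_norm]
    exact norm_snd_le (sphereEmb x - sphereEmb y)
  rw [sphDist_sq, ← sq_abs ((sphereEmb x).2 - _)]
  nlinarith [pow_le_pow_left₀ (norm_nonneg _) h1 2, pow_le_pow_left₀ (abs_nonneg _) h2 2]

theorem invStereo_mem (w : ℂ) : ‖(invStereo w).1‖ ^ 2 + (invStereo w).2 ^ 2 = (invStereo w).2 := by
  have hp : 0 < 1 + ‖w‖ ^ 2 := by positivity
  simp only [invStereo, norm_smul, Real.norm_eq_abs, abs_of_pos (inv_pos.2 hp)]
  field_simp
  ring

theorem exists_sphereEmb_eq {p : ℂ × ℝ} (hp : ‖p.1‖ ^ 2 + p.2 ^ 2 = p.2) :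
    ∃ x, sphereEmb x = p := by
  obtain ⟨u, t⟩ := p
  rcases eq_or_ne t 0 with rfl | ht
  · refine ⟨OnePoint.infty, ?_⟩
    have : u = 0 := by simpa using hp
    rw [this]
    rfl
  · refine ⟨((t⁻¹ • u : ℂ) : OnePoint ℂ), ?_⟩
    change invStereo (t⁻¹ • u) = (u, t)
    have h1 : (1 + ‖t⁻¹ • u‖ ^ 2)⁻¹ = t := by
      rw [norm_smul, mul_pow, norm_inv, Real.norm_eq_abs, inv_pow, sq_abs]
      have : 1 + (t ^ 2)⁻¹ * ‖u‖ ^ 2 = t⁻¹ := by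
        field_simp
        linear_combination hp
      rw [this, inv_inv]
    rw [invStereo, h1, smul_inv_smul₀ ht]

theorem norm_invStereo_le (w : ℂ) : ‖invStereo w‖ ≤ 1 := by
  have h := invStereo_mem w
  have h1 : 0 ≤ (invStereo w).2 := h ▸ by positivity
  have h2 : (invStereo w).2 ≤ 1 := by nlinarith [sq_nonneg ‖(invStereo w).1‖]
  refine norm_prod_le_iff.2 ⟨?_, ?_⟩
  · nlinarith [norm_nonneg (invStereo w).1]
  · rwa [Real.norm_of_nonneg h1]

theorem dist_invStereo_le {h : ℂ → ℂ} {x : ℂ} {s M : ℝ} (hd : DifferentiableOn ℂ h (ball x s))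
    (hM : ∀ w ∈ ball x s, ‖deriv h w‖ ≤ M * (1 + ‖h w‖ ^ 2)) {y y' : ℂ} (hy : y ∈ ball x s)
    (hy' : y' ∈ ball x s) :
    dist (invStereo (h y)) (invStereo (h y')) ≤ 3 * M * dist y y' := by
  have hseg : ∀ t ∈ Icc (0 : ℝ) 1, y' + t * (y - y') ∈ ball x s := fun t ht => by
    simpa using (convex_ball x s).add_smul_sub_mem hy' hy ht
  let c : ℝ → ℂ := fun t => h (y' + t * (y - y'))
  let c' : ℝ → ℂ := fun t => deriv h (y' + t * (y - y')) * (y - y')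
  have hc : ∀ t ∈ Icc (0 : ℝ) 1, HasDerivAt c (c' t) t := fun t ht => by
    have h1 := (hd.differentiableAt (isOpen_ball.mem_nhds (hseg t ht))).hasDerivAt
    have h2 : HasDerivAt (fun t : ℝ => y' + (t : ℂ) * (y - y')) (y - y') t := by
      simpa using ((hasDerivAt_id t).ofReal_comp.mul_const (y - y')).const_add y'
    exact HasDerivAt.comp t (h₂ := h) h1 h2
  have hp : ∀ t, 0 < 1 + ‖c t‖ ^ 2 := fun t => by positivity
  have hderiv : ∀ t ∈ Icc (0 : ℝ) 1, HasDerivAt (fun t => invStereo (c t))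
      ((1 + ‖c t‖ ^ 2)⁻¹ • c' t + (-(2 * inner ℝ (c t) (c' t)) / (1 + ‖c t‖ ^ 2) ^ 2) • c t,
        -(2 * inner ℝ (c t) (c' t)) / (1 + ‖c t‖ ^ 2) ^ 2) t := fun t ht => by
    have h1 := ((hc t ht).norm_sq.const_add 1).fun_inv (hp t).ne'
    exact (h1.smul (hc t ht)).prodMk h1
  have hbound : ∀ t ∈ Icc (0 : ℝ) 1, ‖((1 + ‖c t‖ ^ 2)⁻¹ • c' t +
      (-(2 * inner ℝ (c t) (c' t)) / (1 + ‖c t‖ ^ 2) ^ 2) • c t,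
        -(2 * inner ℝ (c t) (c' t)) / (1 + ‖c t‖ ^ 2) ^ 2)‖ ≤ 3 * M * dist y y' := fun t ht => by
    have hpt := hp t
    have hi := abs_real_inner_le_norm (c t) (c' t)
    have h1 : ‖c' t‖ * (1 + ‖c t‖ ^ 2)⁻¹ ≤ M * dist y y' := by
      rw [← div_eq_mul_inv, div_le_iff₀ hpt, norm_mul, dist_eq_norm]
      calc _ ≤ M * (1 + ‖c t‖ ^ 2) * ‖y - y'‖ := by
            gcongr
            exact hM _ (hseg t ht)
        _ = _ := by ring
    have h0 : 0 ≤ ‖c' t‖ * (1 + ‖c t‖ ^ 2)⁻¹ := by positivity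
    have h2 : ‖-(2 * inner ℝ (c t) (c' t)) / (1 + ‖c t‖ ^ 2) ^ 2‖ * max 1 ‖c t‖ ≤
        2 * (‖c' t‖ * (1 + ‖c t‖ ^ 2)⁻¹) := by
      have h3 : ‖c t‖ * max 1 ‖c t‖ ≤ 1 + ‖c t‖ ^ 2 := by
        rcases max_cases 1 ‖c t‖ with ⟨h, _⟩ | ⟨h, _⟩ <;> rw [h] <;>
          nlinarith [norm_nonneg (c t), sq_nonneg (‖c t‖ - 1)]
      rw [norm_div, norm_neg, norm_mul, Real.norm_ofNat, Real.norm_eq_abs, norm_pow,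
        Real.norm_of_nonneg hpt.le, div_mul_eq_mul_div, div_le_iff₀ (by positivity)]
      calc 2 * |inner ℝ (c t) (c' t)| * max 1 ‖c t‖ ≤ 2 * (‖c t‖ * ‖c' t‖) * max 1 ‖c t‖ := by
            gcongr
        _ = 2 * ‖c' t‖ * (‖c t‖ * max 1 ‖c t‖) := by ring
        _ ≤ 2 * ‖c' t‖ * (1 + ‖c t‖ ^ 2) := by gcongr
        _ = _ := by field_simp
    refine norm_prod_le_iff.2 ⟨(norm_add_le _ _).trans ?_, ?_⟩
    · rw [norm_smul, norm_smul, norm_inv, Real.norm_of_nonneg hpt.le]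
      have := (mul_le_mul_of_nonneg_left (le_max_right 1 ‖c t‖) (norm_nonneg
        (-(2 * inner ℝ (c t) (c' t)) / (1 + ‖c t‖ ^ 2) ^ 2))).trans h2
      linarith
    · have := (le_mul_of_one_le_right (norm_nonneg
        (-(2 * inner ℝ (c t) (c' t)) / (1 + ‖c t‖ ^ 2) ^ 2)) (le_max_left 1 ‖c t‖)).trans h2
      exact this.trans (by linarith)
  have := norm_image_sub_le_of_norm_deriv_le_segment_01'
    (fun t ht => (hderiv t ht).hasDerivWithinAt) fun t ht => hbound t (Ico_subset_Icc_self ht)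
  simpa [c, dist_eq_norm] using this

/-- Sufficiency in Marty's criterion. -/
theorem normalOn_of_norm_deriv_le {𝓖 : Set (ℂ → ℂ)} {U : Set ℂ} (hU : IsOpen U)
    (hd : ∀ h ∈ 𝓖, DifferentiableOn ℂ h U)
    (hM : ∀ x ∈ U, ∃ M : ℝ, ∃ s > 0, ∀ h ∈ 𝓖, ∀ w ∈ ball x s,
      ‖deriv h w‖ ≤ M * (1 + ‖h w‖ ^ 2)) : NormalOn 𝓖 U := by
  intro F hF
  obtain ⟨φ, hφ, G, hG⟩ := exists_subseq_tendstoLocallyUniformlyOn_of_lipschitz (U := U)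
    (fun n z => invStereo (F n z)) fun x hx => by
      obtain ⟨M, s, hs, hMs⟩ := hM x hx
      obtain ⟨r, hr, hrU⟩ := Metric.isOpen_iff.1 hU x hx
      refine ⟨min s r, lt_min hs hr, (ball_subset_ball (min_le_right _ _)).trans hrU, 1, 3 * M,
        Eventually.of_forall fun n y hy => ⟨norm_invStereo_le _, fun y' hy' => ?_⟩⟩
      exact dist_invStereo_le ((hd _ (hF n)).mono ((ball_subset_ball (min_le_right _ _)).trans hrU))
        (fun w hw => hMs _ (hF n) w (ball_subset_ball (min_le_left _ _) hw)) hy hy'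
  have hmem : ∀ y ∈ U, ∃ x, sphereEmb x = G y := fun y hy => by
    refine exists_sphereEmb_eq (IsClosed.mem_of_tendsto
      (s := {p : ℂ × ℝ | ‖p.1‖ ^ 2 + p.2 ^ 2 = p.2})
      (isClosed_eq (by fun_prop) (by fun_prop)) (hG.tendsto_at hy)
      (Eventually.of_forall fun n => invStereo_mem _))
  choose! g hg using hmem
  refine ⟨φ, hφ, g, fun ε hε x hx => ?_⟩
  obtain ⟨t, ht, h⟩ := Metric.tendstoLocallyUniformlyOn_iff.1 hG (ε / 2) (half_pos hε) x hx
  refine ⟨t ∩ U, inter_mem ht self_mem_nhdsWithin, h.mono fun n hn y hy => ?_⟩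
  refine (sphDist_le _ _).trans_lt ?_
  rw [hg y hy.2, dist_comm]
  have := hn y hy.1
  change 2 * dist (G y) (invStereo (F (φ n) y)) < ε
  linarith

/-- If `𝓕` is a family of locally univalent holomorphic functions on `𝔻`, `k ≥ 2`,
and `b` is meromorphic on `𝔻` with `S_k(f)(z) ≠ b(z)` for all `f ∈ 𝓕` and `z ∈ 𝔻`
(the condition is only required at points where `b` is analytic; at poles of `b`
it holds automatically), then `𝓕''/𝓕' = {f''/f' : f ∈ 𝓕}` is normal on `𝔻`. -/
theorem normal_of_Sk_omits_meromorphic (k : ℕ) (hk : 2 ≤ k) (𝓕 : Set (ℂ → ℂ))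
    (hol : ∀ f ∈ 𝓕, AnalyticOnNhd ℂ f unitDisk)
    (univ : ∀ f ∈ 𝓕, ∀ z ∈ unitDisk, deriv f z ≠ 0)
    (b : ℂ → ℂ) (hb : MeromorphicOn b unitDisk)
    (hne : ∀ f ∈ 𝓕, ∀ z ∈ unitDisk, AnalyticAt ℂ b z → Sk k f z ≠ b z) :
    NormalOn {g | ∃ f ∈ 𝓕, g = ldd f} unitDisk := by
  have hd : ∀ f ∈ 𝓕, DifferentiableOn ℂ (ldd f) unitDisk := fun f hf =>
    (hol f hf).deriv.deriv.differentiableOn.div (hol f hf).deriv.differentiableOn (univ f hf)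
  refine normalOn_of_norm_deriv_le isOpen_ball ?_ fun x hx => ?_
  · rintro _ ⟨f, hf, rfl⟩
    exact hd f hf
  · obtain ⟨M, s, hs, hM⟩ := exists_norm_deriv_ldd_le hk (isOpen_ball.mem_nhds hx) (hb x hx)
    refine ⟨M, s, hs, ?_⟩
    rintro _ ⟨f, hf, rfl⟩
    exact hM f (hd f hf) (hne f hf)
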